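/- arXiv:1402.0674 — 4 statements merged into one kernel-verified Lean document; each statement's English description precedes it below -/
import Mathlib

section
/- Let (X,d) be a compact metric space and f : X → X a continuous map. If f is chain-transitive and has the limit shadowing property, then f has the shadowing property. -/
open Filter Topology

variable {X : Type*} [MetricSpace X]

/-- `g` is chain-transitive: for every `δ > 0` and `x, y` there is a finite
`δ`-pseudo-orbit from `x` to `y`. -/
def ChainTransitive (g : X → X) : Prop :=
  ∀ δ : ℝ, 0 < δ → ∀ x y : X, ∃ n : ℕ, 0 < n ∧ ∃ z : ℕ → X,
    z 0 = x ∧ z n = y ∧ ∀ i < n, dist (g (z i)) (z (i + 1)) < δ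

/-- The limit shadowing property for a map `g`. -/
def LimitShadowing (g : X → X) : Prop :=
  ∀ x : ℕ → X,
    Tendsto (fun i : ℕ => dist (g (x i)) (x (i + 1))) atTop (𝓝 0) →
    ∃ y : X, Tendsto (fun i : ℕ => dist (g^[i] y) (x i)) atTop (𝓝 0)

/-- The shadowing property: every `δ`-pseudo-orbit is `ε`-shadowed. -/
def ShadowingProperty (g : X → X) : Prop :=
  ∀ ε : ℝ, 0 < ε → ∃ δ : ℝ, 0 < δ ∧ ∀ x : ℕ → X,
    (∀ i : ℕ, dist (g (x i)) (x (i + 1)) < δ) →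
    ∃ y : X, ∀ i : ℕ, dist (g^[i] y) (x i) < ε

/-- In a compact space, a sequence whose finite initial segments are all `ε`-shadowed
is itself `ε`-shadowed (with non-strict inequalities). -/
theorem exists_shadow_of_finite_shadows [CompactSpace X] {f : X → X} (hf : Continuous f)
    {x : ℕ → X} {ε : ℝ} (h : ∀ N : ℕ, ∃ y : X, ∀ i ≤ N, dist (f^[i] y) (x i) ≤ ε) :
    ∃ y : X, ∀ i : ℕ, dist (f^[i] y) (x i) ≤ ε := by
  have hclosed (N : ℕ) : IsClosed {y : X | ∀ i ≤ N, dist (f^[i] y) (x i) ≤ ε} := by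
    simp only [Set.ofPred_forall]
    exact isClosed_iInter fun i => isClosed_iInter fun _ =>
      isClosed_le ((hf.iterate i).dist continuous_const) continuous_const
  obtain ⟨y, hy⟩ := IsCompact.nonempty_iInter_of_sequence_nonempty_isCompact_isClosed
    (fun N : ℕ => {y : X | ∀ i ≤ N, dist (f^[i] y) (x i) ≤ ε})
    (fun N y hy i hi => hy i (hi.trans N.le_succ)) h (hclosed 0).isCompact hclosed
  exact ⟨y, fun i => Set.mem_iInter.1 hy i i le_rfl⟩

/-- In a chain-transitive system, an initial segment of a `δ`-pseudo-orbit extends to a finite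
`δ`-pseudo-orbit ending at any prescribed point. -/
theorem ChainTransitive.exists_extension {f : X → X} (hct : ChainTransitive f) {δ : ℝ}
    (hδ : 0 < δ) {w : ℕ → X} (hw : ∀ i, dist (f (w i)) (w (i + 1)) < δ) (N : ℕ) (t : X) :
    ∃ (b : ℕ → X) (L : ℕ), N ≤ L ∧ 0 < L ∧ (∀ i ≤ N, b i = w i) ∧ b L = t ∧
      ∀ i < L, dist (f (b i)) (b (i + 1)) < δ := by
  obtain ⟨n, hn, z, hz0, hzn, hz⟩ := hct δ hδ (w N) t
  refine ⟨fun i => if i ≤ N then w i else z (i - N), N + n, by omega, by omega,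
    fun i hi => if_pos hi, ?_, fun i hi => ?_⟩
  · simp [hzn, hn.ne']
  · rcases lt_trichotomy i N with h | rfl | h
    · simpa [h.le, Nat.succ_le_of_lt h] using hw i
    · simpa [hz0] using hz 0 hn
    · have h2 : i + 1 - N = i - N + 1 := by omega
      simpa [h.not_ge, show ¬ i + 1 ≤ N by omega, h2] using hz (i - N) (by omega)

/-- The pair (block index, position in the block) after `n` steps, when reading successively
blocks of lengths `L 0, L 1, …`. -/
def blockPosition (L : ℕ → ℕ) : ℕ → ℕ × ℕ
  | 0 => (0, 0)
  | n + 1 =>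
    let p := blockPosition L n
    if p.2 + 1 < L p.1 then (p.1, p.2 + 1) else (p.1 + 1, 0)

theorem blockPosition_add {L : ℕ → ℕ} {s k : ℕ} (h : blockPosition L s = (k, 0)) {i : ℕ}
    (hi : i < L k) : blockPosition L (s + i) = (k, i) := by
  induction i with
  | zero => exact h
  | succ i ih => simp [blockPosition, ih (by omega), hi]

theorem blockPosition_add_length {L : ℕ → ℕ} {s k : ℕ} (hL : 0 < L k)
    (h : blockPosition L s = (k, 0)) : blockPosition L (s + L k) = (k + 1, 0) := by
  obtain ⟨m, hm⟩ := Nat.exists_eq_add_of_lt hL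
  rw [zero_add] at hm
  have := blockPosition_add h (i := m) (by omega)
  rw [hm, ← add_assoc]
  simp [blockPosition, this, hm]

theorem blockPosition_sum {L : ℕ → ℕ} (hL : ∀ k, 0 < L k) (k : ℕ) :
    blockPosition L (∑ j ∈ Finset.range k, L j) = (k, 0) := by
  induction k with
  | zero => rfl
  | succ k ih => rw [Finset.sum_range_succ, blockPosition_add_length (hL k) ih]

theorem blockPosition_snd_lt {L : ℕ → ℕ} (hL : ∀ k, 0 < L k) (n : ℕ) :
    (blockPosition L n).2 < L (blockPosition L n).1 := by
  induction n with
  | zero => exact hL 0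
  | succ n ih =>
    simp only [blockPosition]
    split_ifs with h
    · exact h
    · exact hL _

theorem monotone_blockPosition_fst (L : ℕ → ℕ) : Monotone fun n => (blockPosition L n).1 := by
  refine monotone_nat_of_le_succ fun n => ?_
  simp only [blockPosition]
  split_ifs <;> simp

theorem tendsto_blockPosition_fst {L : ℕ → ℕ} (hL : ∀ k, 0 < L k) :
    Tendsto (fun n => (blockPosition L n).1) atTop atTop :=
  tendsto_atTop_atTop_of_monotone (monotone_blockPosition_fst L) fun k =>
    ⟨_, (congrArg Prod.fst (blockPosition_sum hL k)).ge⟩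

/-- Finite pseudo-orbits with errors tending to zero, each ending where the next one starts,
concatenate to a limit pseudo-orbit. -/
theorem exists_limit_pseudoOrbit_of_blocks {f : X → X} {b : ℕ → ℕ → X} {L : ℕ → ℕ} {δ : ℕ → ℝ}
    (hδ : Tendsto δ atTop (𝓝 0)) (hL : ∀ k, 0 < L k) (hend : ∀ k, b k (L k) = b (k + 1) 0)
    (hb : ∀ k, ∀ i < L k, dist (f (b k i)) (b k (i + 1)) < δ k) :
    ∃ x : ℕ → X, Tendsto (fun i : ℕ => dist (f (x i)) (x (i + 1))) atTop (𝓝 0) ∧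
      ∀ k, ∀ i ≤ L k, x (∑ j ∈ Finset.range k, L j + i) = b k i := by
  refine ⟨fun n => b (blockPosition L n).1 (blockPosition L n).2, ?_, fun k i hi => ?_⟩
  · refine squeeze_zero (fun _ => dist_nonneg) (fun n => ?_)
      (hδ.comp (tendsto_blockPosition_fst hL))
    have hlt := blockPosition_snd_lt hL n
    have h := (hb _ _ hlt).le
    simp only [blockPosition, Function.comp_apply]
    split_ifs with hc
    · exact h
    · rwa [← hend, ← show (blockPosition L n).2 + 1 = L (blockPosition L n).1 by omega]
  · rcases hi.lt_or_eq with h | rfl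
    · simp [blockPosition_add (blockPosition_sum hL k) h]
    · simp [blockPosition_add_length (hL k) (blockPosition_sum hL k), hend]

/-- A chain-transitive continuous map of a compact metric space with the limit
shadowing property has the shadowing property. -/
theorem stmt4 [CompactSpace X] (f : X → X) (hf : Continuous f)
    (hct : ChainTransitive f) (hls : LimitShadowing f) :
    ShadowingProperty f := by
  intro ε hε
  by_contra! hno
  have hbad (k : ℕ) : ∃ (w : ℕ → X) (N : ℕ),
      (∀ i, dist (f (w i)) (w (i + 1)) < 1 / ((k : ℝ) + 1)) ∧
      ∀ y : X, ∃ i ≤ N, ε / 2 < dist (f^[i] y) (w i) := by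
    obtain ⟨w, hw, hwε⟩ := hno (1 / ((k : ℝ) + 1)) Nat.one_div_pos_of_nat
    by_contra! hfin
    obtain ⟨y, hy⟩ := exists_shadow_of_finite_shadows hf fun N => hfin w N hw
    obtain ⟨i, hi⟩ := hwε y
    linarith [hy i]
  choose w N hw hN using hbad
  choose b L hNL hL hbw hend hb using fun k =>
    hct.exists_extension Nat.one_div_pos_of_nat (hw k) (N k) (w (k + 1) 0)
  obtain ⟨x, hx, hxb⟩ := exists_limit_pseudoOrbit_of_blocks tendsto_one_div_add_atTop_nhds_zero_nat
    hL (fun k => (hend k).trans (hbw (k + 1) 0 (Nat.zero_le _)).symm) hb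
  obtain ⟨y, hy⟩ := hls x hx
  obtain ⟨M, hM⟩ := eventually_atTop.1 (hy.eventually_lt_const (half_pos hε))
  have hMs : M ≤ ∑ j ∈ Finset.range M, L j := by
    simpa using Finset.sum_le_sum fun j (_ : j ∈ Finset.range M) => Nat.succ_le_of_lt (hL j)
  obtain ⟨i, hi, hlt⟩ := hN M (f^[∑ j ∈ Finset.range M, L j] y)
  have hclose := hM (∑ j ∈ Finset.range M, L j + i) (by omega)
  rw [hxb M i (hi.trans (hNL M)), hbw M i hi, add_comm, Function.iterate_add_apply] at hclose
  exact hlt.not_gt hclose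
end

section
/- Let (X,d) be a compact metric space and f : X → X a homeomorphism with the two-sided limit shadowing property. Then f is topologically mixing and has the specification property, the average shadowing property, and the asymptotic average shadowing property. -/
open Filter Topology

variable {X : Type*} [MetricSpace X]

/-- A two-sided limit pseudo-orbit: `d(f(x i), x (i+1)) → 0` as `|i| → ∞`. -/
def IsTwoSidedLimitPseudoOrbit (f : X ≃ X) (x : ℤ → X) : Prop :=
  Tendsto (fun i : ℤ => dist (f (x i)) (x (i + 1))) cofinite (𝓝 0)

/-- `f` has the two-sided limit shadowing property. -/
def TwoSidedLimitShadowing (f : X ≃ X) : Prop :=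
  ∀ x : ℤ → X, IsTwoSidedLimitPseudoOrbit f x →
    ∃ y : X, Tendsto (fun i : ℤ => dist ((f ^ i) y) (x i)) cofinite (𝓝 0)

/-- `g` is topologically mixing. -/
def TopologicallyMixing (g : X → X) : Prop :=
  ∀ U V : Set X, IsOpen U → IsOpen V → U.Nonempty → V.Nonempty →
    ∃ N : ℕ, ∀ n : ℕ, N ≤ n → (g^[n] '' U ∩ V).Nonempty

/-- The specification property: for every `ε > 0` there is `L` such that every
`L`-spaced specification (given by intervals `[a i, b i]` and a map `P` which is a
piece of an orbit on each interval) is `ε`-shadowed by some point. -/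
def SpecificationProperty (f : X ≃ X) : Prop :=
  ∀ ε : ℝ, 0 < ε → ∃ L : ℕ, ∀ m : ℕ, ∀ a b : Fin (m + 1) → ℤ,
    (∀ i, a i ≤ b i) →
    (∀ i : Fin m, b i.castSucc < a i.succ) →
    (∀ i : Fin m, b i.castSucc + (L : ℤ) ≤ a i.succ) →
    ∀ P : ℤ → X,
      (∀ i : Fin (m + 1), ∀ t₁ ∈ Set.Icc (a i) (b i), ∀ t₂ ∈ Set.Icc (a i) (b i),
        (f ^ (t₂ - t₁)) (P t₁) = P t₂) →
      ∃ y : X, ∀ i : Fin (m + 1), ∀ t ∈ Set.Icc (a i) (b i), dist ((f ^ t) y) (P t) < ε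

/-- The average shadowing property. -/
def AverageShadowing (g : X → X) : Prop :=
  ∀ ε : ℝ, 0 < ε → ∃ δ : ℝ, 0 < δ ∧ ∀ x : ℕ → X,
    (∃ N : ℕ, 0 < N ∧ ∀ n : ℕ, N ≤ n → ∀ k : ℕ,
      (∑ i ∈ Finset.range n, dist (g (x (i + k))) (x (i + k + 1))) / n < δ) →
    ∃ y : X, Filter.limsup
      (fun n : ℕ => (∑ i ∈ Finset.range n, dist (g^[i] y) (x i)) / n) atTop < ε

/-- The asymptotic average shadowing property. -/
def AsymptoticAverageShadowing (g : X → X) : Prop :=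
  ∀ x : ℕ → X,
    Tendsto (fun n : ℕ => (∑ i ∈ Finset.range n, dist (g (x i)) (x (i + 1))) / n)
      atTop (𝓝 0) →
    ∃ y : X,
      Tendsto (fun n : ℕ => (∑ i ∈ Finset.range n, dist (g^[i] y) (x i)) / n)
        atTop (𝓝 0)

/-- `y` can be reached from `x` by a `δ`-chain of `g` with exactly `n` steps. -/
def ChainConnected (g : X → X) (δ : ℝ) (n : ℕ) (x y : X) : Prop :=
  ∃ c : ℕ → X, c 0 = x ∧ c n = y ∧ ∀ i < n, dist (g (c i)) (c (i + 1)) < δ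

namespace ChainConnected

variable {g : X → X} {δ : ℝ} {m n : ℕ} {x y z : X}

theorem refl (g : X → X) (δ : ℝ) (x : X) : ChainConnected g δ 0 x x :=
  ⟨fun _ => x, rfl, rfl, fun _ hi => absurd hi (Nat.not_lt_zero _)⟩

theorem single (h : dist (g x) y < δ) : ChainConnected g δ 1 x y := by
  refine ⟨fun i => if i = 0 then x else y, by simp, by simp, fun i hi => ?_⟩
  obtain rfl : i = 0 := by omega
  simpa using h

theorem iterate (hδ : 0 < δ) (n : ℕ) (x : X) : ChainConnected g δ n x (g^[n] x) := by
  refine ⟨fun i => g^[i] x, rfl, rfl, fun i _ => ?_⟩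
  simpa [Function.iterate_succ_apply'] using hδ

theorem trans (h₁ : ChainConnected g δ m x y) (h₂ : ChainConnected g δ n y z) :
    ChainConnected g δ (m + n) x z := by
  obtain ⟨c, hc0, hcm, hc⟩ := h₁
  obtain ⟨d, hd0, hdn, hd⟩ := h₂
  refine ⟨fun i => if i < m then c i else d (i - m), ?_, ?_, fun i hi => ?_⟩
  · rcases Nat.eq_zero_or_pos m with rfl | hm
    · simp [hd0, ← hcm, hc0]
    · simp [hm, hc0]
  · simp [hdn]
  · rcases lt_trichotomy (i + 1) m with h | h | h
    · simpa [h, (Nat.lt_succ_self i).trans h] using hc i (by omega)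
    · have := hc i (by omega)
      simp only [show i < m by omega, h, lt_irrefl, if_true, if_false, Nat.sub_self]
      rwa [hd0, ← hcm, ← h]
    · simp only [show ¬ i < m by omega, show ¬ i + 1 < m by omega, if_false]
      rw [show i + 1 - m = i - m + 1 by omega]
      exact hd _ (by omega)

theorem mul_loop (h : ChainConnected g δ n x x) (q : ℕ) : ChainConnected g δ (q * n) x x := by
  induction q with
  | zero => simpa using refl g δ x
  | succ q ih => simpa [Nat.succ_mul] using ih.trans h

/-- Loops of two consecutive lengths generate loops of every large length. -/
theorem loop_of_le (h₀ : ChainConnected g δ n x x) (h₁ : ChainConnected g δ (n + 1) x x)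
    (hm : n * n ≤ m) : ChainConnected g δ m x x := by
  rcases Nat.eq_zero_or_pos n with rfl | hn
  · simpa using h₁.mul_loop m
  · have hq : n ≤ m / n := (Nat.le_div_iff_mul_le hn).2 hm
    have hr : m % n < n := Nat.mod_lt _ hn
    have key : (m / n - m % n) * n + (m % n) * (n + 1) = m := by
      obtain ⟨e, he⟩ := Nat.exists_eq_add_of_le (hr.le.trans hq)
      have := Nat.div_add_mod m n
      rw [he, Nat.add_sub_cancel_left]
      rw [he] at this
      linarith [this, mul_comm n (m % n + e), add_mul (m % n) e n, mul_add (m % n) n 1]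
    exact key ▸ (h₀.mul_loop _).trans (h₁.mul_loop _)

/-- Both ends of a nontrivial chain may be moved a little, at the cost of one step. -/
theorem perturb {η : ℝ} (hη : 0 ≤ η) {u v : X} (hn : 0 < n) (h : ChainConnected g η n x y)
    (hu : dist (g u) x < η) (hv : dist y v < η) : ChainConnected g (η + η) (n + 1) u v := by
  obtain ⟨c, hc0, hcn, hc⟩ := h
  have h₁ : ChainConnected g (η + η) 1 u x := single (by linarith)
  have h₂ : ChainConnected g (η + η) (n - 1) x (c (n - 1)) :=
    ⟨c, hc0, rfl, fun i hi => (hc i (by omega)).trans_le (by linarith)⟩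
  have h₃ : ChainConnected g (η + η) 1 (c (n - 1)) v := by
    apply single
    have := hc (n - 1) (by omega)
    rw [Nat.sub_add_cancel hn, hcn] at this
    exact (dist_triangle _ y _).trans_lt (by linarith)
  have := (h₁.trans h₂).trans h₃
  rwa [show 1 + (n - 1) + 1 = n + 1 by omega] at this

end ChainConnected

theorem exists_block {T : ℕ → ℕ} (hT : StrictMono T) (h0 : T 0 = 0) (t : ℕ) :
    ∃ k, T k ≤ t ∧ t < T (k + 1) := by
  classical
  have hex : ∃ k, t < T (k + 1) := ⟨t, (Nat.lt_succ_self t).trans_le (hT.le_apply)⟩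
  refine ⟨Nat.find hex, ?_, Nat.find_spec hex⟩
  rcases Nat.eq_zero_or_pos (Nat.find hex) with h | h
  · simp [h, h0]
  · have := Nat.find_min hex (Nat.sub_lt h one_pos)
    rw [show Nat.find hex - 1 + 1 = Nat.find hex by omega] at this
    exact not_lt.1 this

theorem block_unique {T : ℕ → ℕ} (hT : StrictMono T) {t k l : ℕ} (hk : T k ≤ t)
    (hk' : t < T (k + 1)) (hl : T l ≤ t) (hl' : t < T (l + 1)) : k = l := by
  have h₁ := hT.lt_iff_lt.1 (hk.trans_lt hl')
  have h₂ := hT.lt_iff_lt.1 (hl.trans_lt hk')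
  omega

/-- Segments that match at their ends concatenate to a single sequence. -/
theorem exists_concat {α : Type*} {T : ℕ → ℕ} (hT : StrictMono T) (h0 : T 0 = 0) (s : ℕ → ℕ → α)
    (hs : ∀ k, s k (T (k + 1) - T k) = s (k + 1) 0) :
    ∃ x : ℕ → α, ∀ k i, i ≤ T (k + 1) - T k → x (T k + i) = s k i := by
  choose K hK hK' using exists_block hT h0
  have main : ∀ k t, T k ≤ t → t < T (k + 1) → s (K t) (t - T (K t)) = s k (t - T k) := by
    intro k t h h'
    rw [block_unique hT (hK t) (hK' t) h h']
  refine ⟨fun t => s (K t) (t - T (K t)), fun k i hi => ?_⟩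
  have hlt := hT (Nat.lt_succ_self k)
  have hlt' := hT (Nat.lt_succ_self (k + 1))
  simp only [Nat.succ_eq_add_one] at hlt hlt'
  rcases hi.lt_or_eq with h | h
  · simpa using main k (T k + i) (by omega) (by omega)
  · have := main (k + 1) (T k + i) (by omega) (by omega)
    simp only [this]
    rw [h, hs k]
    congr 1
    omega

section Iterates

variable (f : X ≃ₜ X)

theorem zpow_add_apply (m n : ℤ) (x : X) :
    (f.toEquiv ^ (m + n)) x = (f.toEquiv ^ m) ((f.toEquiv ^ n) x) := by
  rw [zpow_add]; rfl

theorem zpow_natCast_apply (n : ℕ) (x : X) : (f.toEquiv ^ (n : ℤ)) x = f^[n] x := by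
  rw [zpow_natCast, Equiv.Perm.iterate_eq_pow f.toEquiv n |>.symm]
  rfl

theorem apply_zpow (n : ℤ) (x : X) : f ((f.toEquiv ^ n) x) = (f.toEquiv ^ (n + 1)) x := by
  rw [add_comm, zpow_add_apply, zpow_one]; rfl

theorem continuous_toEquiv_zpow (n : ℤ) : Continuous (f.toEquiv ^ n) := by
  obtain ⟨k, rfl | rfl⟩ := n.eq_nat_or_neg
  · rw [show ⇑(f.toEquiv ^ (k : ℤ)) = f^[k] from funext (zpow_natCast_apply f k)]
    exact f.continuous.iterate k
  · have : ⇑(f.toEquiv ^ (-(k : ℤ))) = f.symm^[k] := by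
      rw [zpow_neg, ← inv_zpow]
      exact funext (zpow_natCast_apply f.symm k)
    rw [this]
    exact f.symm.continuous.iterate k

theorem chainConnected_zpow {δ : ℝ} (hδ : 0 < δ) {m n : ℤ} {k : ℕ} (hk : n = m + k) (x : X) :
    ChainConnected f δ k ((f.toEquiv ^ m) x) ((f.toEquiv ^ n) x) := by
  rw [hk, add_comm, zpow_add_apply, zpow_natCast_apply]
  exact .iterate hδ k _

end Iterates

section LimitShadowing

variable {f : X ≃ₜ X}

/-- A backward orbit and a forward orbit may be joined by a single orbit. -/
theorem TwoSidedLimitShadowing.exists_connecting (h : TwoSidedLimitShadowing f.toEquiv) (a b : X) :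
    ∃ z : X, ∀ δ > 0, ∃ N : ℕ, ∀ n : ℕ, N ≤ n →
      dist ((f.toEquiv ^ (-n : ℤ)) z) ((f.toEquiv ^ (-n : ℤ)) a) < δ ∧
      dist ((f.toEquiv ^ (n : ℤ)) z) ((f.toEquiv ^ (n : ℤ)) b) < δ := by
  obtain ⟨z, hz⟩ := h (fun i => if i < 0 then (f.toEquiv ^ i) a else (f.toEquiv ^ i) b) (by
    refine Tendsto.congr' (f₁ := fun _ => 0) ?_ tendsto_const_nhds
    have : ∀ᶠ i : ℤ in cofinite, i ≠ -1 :=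
      (Set.finite_singleton (-1 : ℤ)).eventually_cofinite_notMem
    filter_upwards [this] with i hi
    have e (x : X) : f.toEquiv ((f.toEquiv ^ i) x) = (f.toEquiv ^ (i + 1)) x := apply_zpow f i x
    rcases lt_or_ge i 0 with h | h
    · rw [if_pos h, if_pos (by omega), e, dist_self]
    · rw [if_neg (by omega), if_neg (by omega), e, dist_self])
  refine ⟨z, fun δ hδ => ?_⟩
  have hev := hz.eventually (gt_mem_nhds hδ)
  have h₁ := (Nat.cast_injective (R := ℤ)).tendsto_cofinite.eventually hev
  have h₂ := (neg_injective.comp (Nat.cast_injective (R := ℤ))).tendsto_cofinite.eventually hev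
  rw [Nat.cofinite_eq_atTop] at h₁ h₂
  obtain ⟨N, hN⟩ := eventually_atTop.1 ((h₁.and h₂).and (eventually_gt_atTop 0))
  refine ⟨N, fun n hn => ?_⟩
  obtain ⟨⟨h₁, h₂⟩, h₃⟩ := hN n hn
  constructor
  · simpa [h₃] using h₂
  · simpa [show ¬ (n : ℤ) < 0 by omega] using h₁

theorem TwoSidedLimitShadowing.forward (h : TwoSidedLimitShadowing f.toEquiv) (x : ℕ → X)
    (hx : Tendsto (fun i => dist (f (x i)) (x (i + 1))) atTop (𝓝 0)) :
    ∃ y, Tendsto (fun i => dist (f^[i] y) (x i)) atTop (𝓝 0) := by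
  obtain ⟨y, hy⟩ := h (fun i => if i < 0 then (f.toEquiv ^ i) (x 0) else x i.toNat) (by
    refine Metric.tendsto_nhds.2 fun ε hε => ?_
    obtain ⟨N, hN⟩ := eventually_atTop.1 (Metric.tendsto_nhds.1 hx ε hε)
    rw [eventually_cofinite]
    refine (Set.finite_Icc (-1 : ℤ) N).subset fun i hi => ?_
    by_contra hc
    apply hi
    have e (x : X) : f.toEquiv ((f.toEquiv ^ i) x) = (f.toEquiv ^ (i + 1)) x := apply_zpow f i x
    rw [Set.mem_Icc, not_and_or, not_le, not_le] at hc
    rcases hc with hc | hc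
    · beta_reduce
      rw [if_pos (by omega), if_pos (by omega), e, dist_self, dist_self]
      exact hε
    · lift i to ℕ using by omega
      simpa [show ¬ (i : ℤ) < 0 by omega, show ¬ (i : ℤ) + 1 < 0 by omega, show ((i : ℤ) + 1).toNat = i + 1 by omega]
        using hN i (by omega))
  refine ⟨y, ?_⟩
  have := hy.comp (Nat.cast_injective (R := ℤ)).tendsto_cofinite
  rw [Nat.cofinite_eq_atTop] at this
  refine this.congr fun i => ?_
  simp [Function.comp, ← zpow_natCast_apply, show ¬ (i : ℤ) < 0 by omega]

end LimitShadowing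

section ChainMixing

variable [CompactSpace X] {f : X ≃ₜ X}

theorem exists_chainConnected_omega (f : X ≃ₜ X) (x : X) :
    ∃ a, ∀ δ > 0, ∀ n : ℤ, ∃ m, ∀ w, dist ((f.toEquiv ^ n) a) w < δ →
      ChainConnected f (δ + δ) m x w := by
  obtain ⟨a, φ, hφ, ha⟩ := CompactSpace.tendsto_subseq (fun i : ℕ => (f.toEquiv ^ (i : ℤ)) x)
  refine ⟨a, fun δ hδ n => ?_⟩
  have h₁ := ((continuous_toEquiv_zpow f n).tendsto a).comp ha
  obtain ⟨j, hj, hj'⟩ := ((Metric.tendsto_nhds.1 h₁ δ hδ).and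
    (hφ.tendsto_atTop.eventually (eventually_ge_atTop (1 - n).toNat))).exists
  simp only [Function.comp, ← zpow_add_apply] at hj
  obtain ⟨m, hm⟩ := Int.eq_ofNat_of_zero_le (show 0 ≤ n + φ j - 1 by omega)
  refine ⟨m + 1, fun w hw => ?_⟩
  have h₂ : ChainConnected f (δ + δ) m x ((f.toEquiv ^ (n + φ j - 1)) x) :=
    chainConnected_zpow f (by linarith) (m := 0) (by omega) x
  refine h₂.trans (.single ?_)
  rw [apply_zpow, sub_add_cancel]
  exact (dist_triangle _ _ _).trans_lt (add_lt_add hj hw)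

theorem exists_chainConnected_alpha (f : X ≃ₜ X) (y : X) :
    ∃ b, ∀ δ > 0, ∀ n : ℤ, ∃ m, ∀ w, dist (f w) ((f.toEquiv ^ n) b) < δ →
      ChainConnected f (δ + δ) m w y := by
  obtain ⟨b, φ, hφ, hb⟩ := CompactSpace.tendsto_subseq (fun i : ℕ => (f.toEquiv ^ (-i : ℤ)) y)
  refine ⟨b, fun δ hδ n => ?_⟩
  have h₁ := ((continuous_toEquiv_zpow f n).tendsto b).comp hb
  obtain ⟨j, hj, hj'⟩ := ((Metric.tendsto_nhds.1 h₁ δ hδ).and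
    (hφ.tendsto_atTop.eventually (eventually_ge_atTop n.toNat))).exists
  simp only [Function.comp, ← zpow_add_apply] at hj
  obtain ⟨m, hm⟩ := Int.eq_ofNat_of_zero_le (show 0 ≤ φ j - n by omega)
  refine ⟨1 + m, fun w hw => ?_⟩
  have h₂ : ChainConnected f (δ + δ) m ((f.toEquiv ^ (n + -φ j)) y) y :=
    chainConnected_zpow f (by linarith) (n := 0) (by omega) y
  refine ChainConnected.trans (.single ?_) h₂
  rw [dist_comm] at hj
  exact (dist_triangle _ _ _).trans_lt (add_lt_add hw hj)

theorem TwoSidedLimitShadowing.exists_consecutive_chains (h : TwoSidedLimitShadowing f.toEquiv)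
    {δ : ℝ} (hδ : 0 < δ) (x y : X) :
    ∃ n, ChainConnected f δ n x y ∧ ChainConnected f δ (n + 1) x y := by
  obtain ⟨a, ha⟩ := exists_chainConnected_omega f x
  obtain ⟨b, hb⟩ := exists_chainConnected_alpha f y
  obtain ⟨u, hu⟩ := h.exists_connecting a b
  obtain ⟨v, hv⟩ := h.exists_connecting a (f b)
  have hδ2 : 0 < δ / 2 := half_pos hδ
  obtain ⟨N₁, hN₁⟩ := hu (δ / 2) hδ2
  obtain ⟨N₂, hN₂⟩ := hv (δ / 2) hδ2
  set N := max N₁ N₂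
  obtain ⟨m, hm⟩ := ha (δ / 2) hδ2 (-N)
  obtain ⟨k, hk⟩ := hb (δ / 2) hδ2 (N + 2)
  rw [add_halves] at hm hk
  refine ⟨m + (2 * N) + k, ?_, ?_⟩
  · refine ((hm ((f.toEquiv ^ (-N : ℤ)) v) ?_).trans
      (chainConnected_zpow f hδ (n := N) (by push_cast; ring) v)).trans (hk _ ?_)
    · rw [dist_comm]
      exact (hN₂ N (le_max_right _ _)).1
    · have := (hN₂ (N + 1) ((le_max_right _ _).trans (Nat.le_succ _))).2
      have e : (f.toEquiv ^ ((N + 1 : ℕ) : ℤ)) (f b) = (f.toEquiv ^ ((N : ℤ) + 2)) b := by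
        rw [show (N : ℤ) + 2 = ((N + 1 : ℕ) : ℤ) + 1 by push_cast; ring, zpow_add_apply, zpow_one]
        rfl
      rw [e] at this
      rw [apply_zpow]
      exact_mod_cast this
  · rw [show m + 2 * N + k + 1 = m + (2 * N + 1) + k by ring]
    refine ((hm ((f.toEquiv ^ (-N : ℤ)) u) ?_).trans
      (chainConnected_zpow f hδ (n := N + 1) (by push_cast; ring) u)).trans (hk _ ?_)
    · rw [dist_comm]
      exact (hN₁ N (le_max_left _ _)).1
    · have := (hN₁ (N + 2) ((le_max_left _ _).trans (Nat.le_add_right _ _))).2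
      rw [apply_zpow, add_assoc]
      exact_mod_cast this

/-- Two-sided limit shadowing implies chain mixing, uniformly in the end points. -/
theorem TwoSidedLimitShadowing.chain_mixing (h : TwoSidedLimitShadowing f.toEquiv)
    {δ : ℝ} (hδ : 0 < δ) : ∃ N, ∀ n, N ≤ n → ∀ x y, ChainConnected f δ n x y := by
  have pointwise : ∀ x y, ∃ N, ∀ n, N ≤ n → ChainConnected f (δ / 2) n x y := by
    intro x y
    obtain ⟨l, h₀, h₁⟩ := h.exists_consecutive_chains (half_pos hδ) x x
    obtain ⟨k, hk, -⟩ := h.exists_consecutive_chains (half_pos hδ) x y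
    refine ⟨l * l + k, fun n hn => ?_⟩
    have := (h₀.loop_of_le h₁ (m := n - k) (by omega)).trans hk
    rwa [Nat.sub_add_cancel (by omega)] at this
  choose M hM using pointwise
  obtain ⟨t, htf, ht⟩ := Metric.totallyBounded_iff.1 (isCompact_univ (X := X)).totallyBounded
    (δ / 2) (half_pos hδ)
  have near : ∀ x, ∃ p ∈ t, dist x p < δ / 2 := fun x => by
    simpa using ht (Set.mem_univ x)
  obtain ⟨N, hN⟩ := ((htf.prod htf).image fun p : X × X => M p.1 p.2).bddAbove
  refine ⟨N + 2, fun n hn x y => ?_⟩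
  obtain ⟨p, hp, hxp⟩ := near (f x)
  obtain ⟨q, hq, hyq⟩ := near y
  have hle : M p q ≤ N := hN ⟨(p, q), ⟨hp, hq⟩, rfl⟩
  rw [dist_comm] at hyq
  have := (hM p q (n - 1) (by omega)).perturb (half_pos hδ).le (by omega) hxp hyq
  rwa [add_halves, Nat.sub_add_cancel (by omega)] at this

end ChainMixing

section Shadowing

variable [CompactSpace X] {f : X ≃ₜ X}

/-- Finite chains are shadowed by orbits. -/
theorem TwoSidedLimitShadowing.finite_shadowing (h : TwoSidedLimitShadowing f.toEquiv)
    {ε : ℝ} (hε : 0 < ε) : ∃ δ > 0, ∀ (n : ℕ) (c : ℕ → X),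
      (∀ i < n, dist (f (c i)) (c (i + 1)) < δ) → ∃ y, ∀ i ≤ n, dist (f^[i] y) (c i) < ε := by
  by_contra! hcon
  have hpos : ∀ k : ℕ, (0 : ℝ) < 1 / ((k : ℝ) + 1) := fun k => Nat.one_div_pos_of_nat
  choose n c hc hbad using fun k => hcon _ (hpos k)
  have conn : ∀ k : ℕ, ∃ l, 0 < l ∧
      ChainConnected f (1 / ((k : ℝ) + 1)) l (c k (n k)) (c (k + 1) 0) := by
    intro k
    obtain ⟨N, hN⟩ := h.chain_mixing (hpos k)
    exact ⟨N + 1, N.succ_pos, hN _ N.le_succ _ _⟩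
  choose l hl e he0 hel he using conn
  set T : ℕ → ℕ := fun k => ∑ j ∈ Finset.range k, (n j + l j)
  have hTs : ∀ k, T (k + 1) = T k + (n k + l k) := fun k => Finset.sum_range_succ _ _
  have hT : StrictMono T := strictMono_nat_of_lt_succ fun k => by have := hl k; rw [hTs]; omega
  have hT0 : T 0 = 0 := rfl
  obtain ⟨x, hx⟩ := exists_concat hT hT0
    (fun k i => if i ≤ n k then c k i else e k (i - n k)) (by
      intro k
      have := hl k
      simp only [hTs, Nat.add_sub_cancel_left, Nat.zero_le, if_true]
      rw [if_neg (by omega), hel])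
  have hstep : ∀ k t, T k ≤ t → t < T (k + 1) →
      dist (f (x t)) (x (t + 1)) < 1 / ((k : ℝ) + 1) := by
    intro k t h₁ h₂
    obtain ⟨i, rfl⟩ := Nat.exists_eq_add_of_le h₁
    rw [add_assoc, hx k i (by omega), hx k (i + 1) (by omega)]
    have := hTs k
    rcases lt_trichotomy i (n k) with hi | hi | hi
    · rw [if_pos hi.le, if_pos (by omega)]
      exact hc k i hi
    · rw [if_pos hi.le, if_neg (by omega), hi, ← he0]
      simpa using he k 0 (hl k)
    · rw [if_neg (by omega), if_neg (by omega), show i + 1 - n k = i - n k + 1 by omega]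
      exact he k _ (by omega)
  obtain ⟨y, hy⟩ := h.forward x (by
    refine Metric.tendsto_nhds.2 fun η hη => ?_
    obtain ⟨k, hk⟩ := exists_nat_one_div_lt hη
    filter_upwards [eventually_ge_atTop (T k)] with t ht
    obtain ⟨j, hj, hj'⟩ := exists_block hT hT0 t
    have hkj : k ≤ j := Nat.lt_succ_iff.1 (hT.lt_iff_lt.1 (ht.trans_lt hj'))
    rw [Real.dist_0_eq_abs, abs_of_nonneg dist_nonneg]
    exact (hstep j t hj hj').trans_le ((Nat.one_div_le_one_div hkj).trans hk.le))
  obtain ⟨K, hK⟩ := eventually_atTop.1 (hy.eventually (gt_mem_nhds hε))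
  obtain ⟨i, hi, hi'⟩ := hbad K (f^[T K] y)
  have := hK (T K + i) (hT.le_apply.trans (Nat.le_add_right _ _))
  have hTK := hTs K
  rw [hx K i (by omega), if_pos hi, add_comm, Function.iterate_add_apply] at this
  exact absurd this (not_lt.2 hi')

theorem TwoSidedLimitShadowing.shadowing (h : TwoSidedLimitShadowing f.toEquiv)
    {ε : ℝ} (hε : 0 < ε) : ∃ δ > 0, ∀ x : ℕ → X,
      (∀ i, dist (f (x i)) (x (i + 1)) < δ) → ∃ y, ∀ i, dist (f^[i] y) (x i) ≤ ε := by
  obtain ⟨δ, hδ, hs⟩ := h.finite_shadowing hε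
  refine ⟨δ, hδ, fun x hx => ?_⟩
  choose y hy using fun n => hs n x fun i _ => hx i
  obtain ⟨z, φ, hφ, hz⟩ := CompactSpace.tendsto_subseq y
  refine ⟨z, fun i => ?_⟩
  refine le_of_tendsto ((((f.continuous.iterate i).tendsto z).comp hz).dist
    (tendsto_const_nhds (x := x i))) ?_
  filter_upwards [hφ.tendsto_atTop.eventually (eventually_ge_atTop i)] with j hj
  exact (hy (φ j) i hj).le

theorem TwoSidedLimitShadowing.specificationProperty (h : TwoSidedLimitShadowing f.toEquiv) :
    SpecificationProperty f.toEquiv := by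
  intro ε hε
  obtain ⟨δ, hδ, hs⟩ := h.finite_shadowing hε
  obtain ⟨L, hL⟩ := h.chain_mixing hδ
  refine ⟨L, fun m a b hab hlt hgap P hP => ?_⟩
  have horb : ∀ i : Fin (m + 1), ∀ t, a i ≤ t → t < b i → f (P t) = P (t + 1) := by
    intro i t h₁ h₂
    have := hP i t ⟨h₁, h₂.le⟩ (t + 1) ⟨by omega, by omega⟩
    rwa [add_sub_cancel_left, zpow_one] at this
  have hmono : Monotone b := Fin.monotone_iff_le_succ.2 fun i =>
    (hlt i).le.trans (hab _)
  have key : ∀ k (hk : k < m + 1), ∃ x : ℤ → X,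
      (∀ i : Fin (m + 1), i ≤ ⟨k, hk⟩ → ∀ t ∈ Set.Icc (a i) (b i), x t = P t) ∧
      ∀ t, a 0 ≤ t → t < b ⟨k, hk⟩ → dist (f (x t)) (x (t + 1)) < δ := by
    intro k
    induction k with
    | zero =>
      refine fun hk => ⟨P, fun _ _ _ _ => rfl, fun t h₁ h₂ => ?_⟩
      rw [horb 0 t h₁ h₂, dist_self]
      exact hδ
    | succ k ih =>
      intro hk
      obtain ⟨x, hx, hx'⟩ := ih (by omega)
      have g₁ := hlt ⟨k, by omega⟩
      have g₂ := hgap ⟨k, by omega⟩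
      set p : Fin (m + 1) := ⟨k, by omega⟩
      set q : Fin (m + 1) := ⟨k + 1, hk⟩
      change b p < a q at g₁
      change b p + L ≤ a q at g₂
      obtain ⟨n, hn⟩ := Int.eq_ofNat_of_zero_le (show 0 ≤ a q - b p by omega)
      obtain ⟨c, hc0, hcn, hc⟩ := hL n (by omega) (P (b p)) (P (a q))
      refine ⟨fun t => if t ≤ b p then x t else if t < a q then c (t - b p).toNat else P t,
        fun i hi t ht => ?_, fun t h₁ h₂ => ?_⟩
      · rcases hi.lt_or_eq with hi | hi
        · have hip : i ≤ p := Nat.lt_succ_iff.1 hi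
          simp only [ht.2.trans (hmono hip), if_true]
          exact hx i hip t ht
        · subst hi
          simp only [show ¬ t ≤ b p from not_le.2 (g₁.trans_le ht.1), not_lt.2 ht.1, if_false]
      · have hxb : x (b p) = c 0 := by
          rw [hc0]
          exact hx p le_rfl _ ⟨hab p, le_rfl⟩
        simp only
        rcases lt_or_ge t (b p) with h₃ | h₃
        · rw [if_pos h₃.le, if_pos (by omega)]
          exact hx' t h₁ h₃
        rcases lt_or_ge t (a q) with h₄ | h₄
        · have e₁ : (if t ≤ b p then x t else if t < a q then c (t - b p).toNat else P t)
              = c (t - b p).toNat := by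
            rcases h₃.eq_or_lt with h₅ | h₅
            · rw [if_pos h₅.ge, ← h₅, hxb, sub_self]; rfl
            · rw [if_neg (by omega), if_pos h₄]
          have e₂ : (if t + 1 < a q then c (t + 1 - b p).toNat else P (t + 1))
              = c ((t - b p).toNat + 1) := by
            rw [show (t + 1 - b p).toNat = (t - b p).toNat + 1 by omega]
            split_ifs with h₅
            · rfl
            · rw [show (t - b p).toNat + 1 = n by omega, hcn, show t + 1 = a q by omega]
          rw [e₁, if_neg (show ¬ t + 1 ≤ b p by omega), e₂]
          exact hc _ (by omega)
        · rw [if_neg (by omega), if_neg (by omega), if_neg (by omega), if_neg (by omega),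
            horb q t h₄ h₂, dist_self]
          exact hδ
  obtain ⟨x, hx, hx'⟩ := key m (Nat.lt_succ_self m)
  have hle : a 0 ≤ b (Fin.last m) := (hab 0).trans (hmono (Fin.zero_le _))
  obtain ⟨n, hn⟩ := Int.eq_ofNat_of_zero_le (sub_nonneg.2 hle)
  have hamono : ∀ i, a 0 ≤ a i := by
    have : Monotone a := Fin.monotone_iff_le_succ.2 fun i => (hab _).trans (hlt i).le
    exact fun i => this (Fin.zero_le i)
  obtain ⟨y, hy⟩ := hs n (fun i => x (a 0 + i)) (by
    intro i hi
    have := hx' (a 0 + i) (by omega) (show a 0 + i < b (Fin.last m) by omega)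
    push_cast
    rwa [← add_assoc])
  refine ⟨(f.toEquiv ^ (-a 0)) y, fun i t ht => ?_⟩
  have h₁ := hamono i
  have h₂ := hmono (Fin.le_last i)
  have h₃ := ht.1
  have h₄ := ht.2
  obtain ⟨j, hj⟩ := Int.eq_ofNat_of_zero_le (show 0 ≤ t - a 0 by omega)
  have := hy j (by omega)
  rw [show a 0 + (j : ℤ) = t by omega, hx i (Fin.le_last i) t ht, ← zpow_natCast_apply, ← hj,
    sub_eq_add_neg, zpow_add_apply] at this
  exact this

end Shadowing

theorem SpecificationProperty.topologicallyMixing {f : X ≃ₜ X}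
    (h : SpecificationProperty f.toEquiv) : TopologicallyMixing f := by
  intro U V hU hV ⟨u, hu⟩ ⟨v, hv⟩
  obtain ⟨r, hr, hrU⟩ := Metric.isOpen_iff.1 hU u hu
  obtain ⟨s, hs, hsV⟩ := Metric.isOpen_iff.1 hV v hv
  obtain ⟨L, hL⟩ := h (min r s) (lt_min hr hs)
  refine ⟨L + 1, fun n hn => ?_⟩
  obtain ⟨y, hy⟩ := hL 1 ![0, (n : ℤ)] ![0, (n : ℤ)] (fun _ => le_rfl)
    (by intro i; fin_cases i; simpa using (by omega : 0 < n))
    (by intro i; fin_cases i; simpa using (by omega : L ≤ n))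
    (fun t => if t = 0 then u else v) (by
      intro i t₁ ht₁ t₂ ht₂
      rw [Set.Icc_self, Set.mem_singleton_iff] at ht₁ ht₂
      rw [ht₁, ht₂, sub_self, zpow_zero]
      rfl)
  have h₀ := hy 0 0 (by simp)
  have h₁ := hy 1 n (by simp)
  rw [if_neg (by omega), zpow_natCast_apply] at h₁
  exact ⟨f^[n] y, ⟨y, hrU (by simpa using h₀.trans_le (min_le_left _ _)), rfl⟩,
    hsV (h₁.trans_le (min_le_right _ _))⟩

section Average

variable {g : X → X}

/-- A sequence is replaced, on the blocks containing a large jump, by a chain with the same ends. -/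
theorem exists_block_modification {D : ℝ} (hD : ∀ x y : X, dist x y ≤ D) {T : ℕ → ℕ}
    (hT : StrictMono T) (h0 : T 0 = 0) {η : ℕ → ℝ} (hη : ∀ j, 0 < η j)
    (hconn : ∀ j u v, ChainConnected g (η j) (T (j + 1) - T j) u v) (x : ℕ → X) :
    ∃ x' : ℕ → X, ∀ j i, T j ≤ i → i < T (j + 1) → dist (g (x' i)) (x' (i + 1)) < η j ∧
      dist (x' i) (x i) ≤
        D / η j * ∑ l ∈ Finset.Ico (T j) (T (j + 1)), dist (g (x l)) (x (l + 1)) := by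
  have seg : ∀ j, ∃ s : ℕ → X, s 0 = x (T j) ∧ s (T (j + 1) - T j) = x (T (j + 1)) ∧
      (∀ i < T (j + 1) - T j, dist (g (s i)) (s (i + 1)) < η j) ∧
      ∀ i < T (j + 1) - T j, dist (s i) (x (T j + i)) ≤
        D / η j * ∑ l ∈ Finset.Ico (T j) (T (j + 1)), dist (g (x l)) (x (l + 1)) := by
    intro j
    have hD0 : 0 ≤ D := dist_nonneg.trans (hD (x 0) (x 0))
    have hlt := hT (Nat.lt_succ_self j)
    rw [Nat.succ_eq_add_one] at hlt
    by_cases hgood : ∀ l ∈ Finset.Ico (T j) (T (j + 1)), dist (g (x l)) (x (l + 1)) < η j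
    · refine ⟨fun i => x (T j + i), rfl, by simp only; congr 1; omega, fun i hi => ?_, fun i hi => ?_⟩
      · exact hgood _ (Finset.mem_Ico.2 ⟨by omega, by omega⟩)
      · rw [dist_self]
        exact mul_nonneg (div_nonneg hD0 (hη j).le) (Finset.sum_nonneg fun _ _ => dist_nonneg)
    · push Not at hgood
      obtain ⟨l, hl, hbad⟩ := hgood
      obtain ⟨c, hc0, hcn, hc⟩ := hconn j (x (T j)) (x (T (j + 1)))
      refine ⟨c, hc0, hcn, hc, fun i _ => (hD _ _).trans ?_⟩
      calc D = D / η j * η j := (div_mul_cancel₀ D (hη j).ne').symm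
        _ ≤ _ := mul_le_mul_of_nonneg_left (hbad.trans (Finset.single_le_sum
          (f := fun l => dist (g (x l)) (x (l + 1))) (fun _ _ => dist_nonneg) hl))
          (div_nonneg hD0 (hη j).le)
  choose s hs0 hs1 hs2 hs3 using seg
  obtain ⟨x', hx'⟩ := exists_concat hT h0 s fun k => (hs1 k).trans (hs0 (k + 1)).symm
  refine ⟨x', fun j i h₁ h₂ => ?_⟩
  obtain ⟨i, rfl⟩ := Nat.exists_eq_add_of_le h₁
  rw [add_assoc, hx' j i (by omega), hx' j (i + 1) (by omega)]
  exact ⟨hs2 j i (by omega), hs3 j i (by omega)⟩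

theorem sum_range_block_le {α β : ℕ → ℝ} {T : ℕ → ℕ} (hT : Monotone T) (h0 : T 0 = 0)
    {C : ℝ} {w : ℕ → ℝ} (hα : ∀ l, 0 ≤ α l) (J : ℕ)
    (hw : ∀ j < J, ((T (j + 1) - T j : ℕ) : ℝ) * w j ≤ C)
    (hβ : ∀ j i, T j ≤ i → i < T (j + 1) →
      β i ≤ w j * ∑ l ∈ Finset.Ico (T j) (T (j + 1)), α l) :
    ∑ i ∈ Finset.range (T J), β i ≤ C * ∑ l ∈ Finset.range (T J), α l := by
  induction J with
  | zero => simp [h0]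
  | succ J ih =>
    have hle : T J ≤ T (J + 1) := hT J.le_succ
    rw [← Finset.sum_range_add_sum_Ico β hle, ← Finset.sum_range_add_sum_Ico α hle, mul_add]
    refine add_le_add (ih fun j hj => hw j (hj.trans J.lt_succ_self)) ?_
    calc ∑ i ∈ Finset.Ico (T J) (T (J + 1)), β i
        ≤ ∑ i ∈ Finset.Ico (T J) (T (J + 1)), w J * ∑ l ∈ Finset.Ico (T J) (T (J + 1)), α l :=
          Finset.sum_le_sum fun i hi => hβ J i (Finset.mem_Ico.1 hi).1 (Finset.mem_Ico.1 hi).2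
      _ = ((T (J + 1) - T J : ℕ) : ℝ) * w J * ∑ l ∈ Finset.Ico (T J) (T (J + 1)), α l := by
          rw [Finset.sum_const, Nat.card_Ico, nsmul_eq_mul, mul_assoc]
      _ ≤ _ := mul_le_mul_of_nonneg_right (hw J J.lt_succ_self)
          (Finset.sum_nonneg fun _ _ => hα _)

theorem exists_dist_bound (X : Type*) [MetricSpace X] [CompactSpace X] :
    ∃ D : ℝ, 0 < D ∧ ∀ x y : X, dist x y ≤ D :=
  ⟨Metric.diam (Set.univ : Set X) + 1, by positivity, fun x y =>
    (Metric.dist_le_diam_of_mem isCompact_univ.isBounded (Set.mem_univ x)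
      (Set.mem_univ y)).trans (by linarith)⟩

theorem sum_range_le_of_le {α : ℕ → ℝ} (hα : ∀ l, 0 ≤ α l) {m n : ℕ} (h : m ≤ n) :
    ∑ l ∈ Finset.range m, α l ≤ ∑ l ∈ Finset.range n, α l :=
  Finset.sum_le_sum_of_subset_of_nonneg (Finset.range_mono h) fun _ _ _ => hα _

end Average

section AverageShadowing

variable [CompactSpace X] {f : X ≃ₜ X}

theorem TwoSidedLimitShadowing.averageShadowing (h : TwoSidedLimitShadowing f.toEquiv) :
    AverageShadowing f := by
  intro ε hε
  obtain ⟨D, hD0, hD⟩ := exists_dist_bound X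
  obtain ⟨δ, hδ, hs⟩ := h.shadowing (ε := ε / 3) (by linarith)
  obtain ⟨M, hM⟩ := h.chain_mixing hδ
  set N := M + 1
  have hN : (0 : ℝ) < N := by positivity
  have hC : 0 < N * (D / δ) := by positivity
  refine ⟨ε / (6 * (N * (D / δ))), by positivity, fun x ⟨N₀, hN₀, hx⟩ => ?_⟩
  set α : ℕ → ℝ := fun l => dist (f (x l)) (x (l + 1)) with hαdef
  have hα : ∀ l, 0 ≤ α l := fun _ => dist_nonneg
  have hT : StrictMono fun j => j * N := fun i j hij =>
    Nat.mul_lt_mul_of_pos_right hij M.succ_pos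
  have hlen : ∀ j, (j + 1) * N - j * N = N := fun j => by
    rw [Nat.succ_mul, Nat.add_sub_cancel_left]
  obtain ⟨x', hx'⟩ := exists_block_modification (g := f) hD hT (Nat.zero_mul N) (η := fun _ => δ)
    (fun _ => hδ) (fun j u v => by rw [hlen]; exact hM N M.le_succ u v) x
  have hstep : ∀ i, dist (f (x' i)) (x' (i + 1)) < δ := fun i => by
    obtain ⟨j, hj, hj'⟩ := exists_block hT (Nat.zero_mul N) i
    exact (hx' j i hj hj').1
  obtain ⟨y, hy⟩ := hs x' hstep
  refine ⟨y, lt_of_le_of_lt (limsup_le_of_le ?_ ?_) (show 2 * ε / 3 < ε by linarith)⟩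
  · refine IsBoundedUnder.isCoboundedUnder_le ⟨0, eventually_map.2 (Eventually.of_forall fun n => ?_)⟩
    exact div_nonneg (Finset.sum_nonneg fun _ _ => dist_nonneg) (Nat.cast_nonneg n)
  filter_upwards [eventually_ge_atTop (max N N₀)] with n hn
  have hnN : N ≤ n := (le_max_left _ _).trans hn
  have hn0 : (0 : ℝ) < n := by exact_mod_cast (Nat.succ_pos M).trans_le hnN
  rw [div_le_iff₀ hn0]
  have hmod : ∑ i ∈ Finset.range n, dist (x' i) (x i) ≤ ε / 3 * n := by
    obtain ⟨j, hj, hj'⟩ := exists_block hT (Nat.zero_mul N) n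
    have h2n : (j + 1) * N ≤ n + n := by
      rw [Nat.succ_mul]
      exact add_le_add hj hnN
    have havg : ∑ l ∈ Finset.range (n + n), α l ≤ ε / (6 * (N * (D / δ))) * (n + n) := by
      have := (hx (n + n) (by have := (le_max_right N N₀).trans hn; omega) 0).le
      rw [Nat.cast_add, div_le_iff₀ (add_pos hn0 hn0)] at this
      simpa [hαdef] using this
    calc ∑ i ∈ Finset.range n, dist (x' i) (x i)
        ≤ ∑ i ∈ Finset.range ((j + 1) * N), dist (x' i) (x i) :=
          sum_range_le_of_le (fun _ => dist_nonneg) hj'.le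
      _ ≤ N * (D / δ) * ∑ l ∈ Finset.range ((j + 1) * N), α l :=
          sum_range_block_le hT.monotone (Nat.zero_mul N) (w := fun _ => D / δ) hα (j + 1)
            (fun i _ => by rw [hlen]) fun j i h₁ h₂ => (hx' j i h₁ h₂).2
      _ ≤ N * (D / δ) * (ε / (6 * (N * (D / δ))) * (n + n)) :=
          mul_le_mul_of_nonneg_left ((sum_range_le_of_le hα h2n).trans havg) hC.le
      _ = ε / 3 * n := by field_simp; ring
  calc ∑ i ∈ Finset.range n, dist (f^[i] y) (x i)
      ≤ ∑ i ∈ Finset.range n, (ε / 3 + dist (x' i) (x i)) :=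
        Finset.sum_le_sum fun i _ => (dist_triangle _ (x' i) _).trans (by linarith [hy i])
    _ = ε / 3 * n + ∑ i ∈ Finset.range n, dist (x' i) (x i) := by
        rw [Finset.sum_add_distrib, Finset.sum_const, Finset.card_range, nsmul_eq_mul, mul_comm]
    _ ≤ 2 * ε / 3 * n := by linarith

/-- Eventual properties hold along a slowly growing choice of the parameter. -/
theorem exists_slow_monotone {p : ℕ → ℕ → Prop} (hp : ∀ k, ∀ᶠ n in atTop, p k n) :
    ∃ K : ℕ → ℕ, Monotone K ∧ Tendsto K atTop atTop ∧ ∀ᶠ n in atTop, p (K n) n := by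
  classical
  obtain ⟨S, hS, hpS⟩ := extraction_forall_of_eventually (P := fun k n => ∀ m, n ≤ m → p k m)
    fun k => (eventually_atTop.1 (hp k)).elim fun N hN =>
      eventually_atTop.2 ⟨N, fun n hn m hm => hN m (hn.trans hm)⟩
  have hmono : Monotone fun n => Nat.findGreatest (fun k => S k ≤ n) n := fun m n hmn =>
    Nat.findGreatest_mono (fun k hk => le_trans hk hmn) hmn
  refine ⟨fun n => Nat.findGreatest (fun k => S k ≤ n) n, hmono, ?_, ?_⟩
  · exact tendsto_atTop_atTop.2 fun b => ⟨S b, fun n hn =>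
      Nat.le_findGreatest (hS.le_apply.trans hn) hn⟩
  · filter_upwards [eventually_ge_atTop (S 0)] with n hn
    exact hpS _ n (Nat.findGreatest_spec (P := fun k => S k ≤ n) (Nat.zero_le n) hn)

theorem TwoSidedLimitShadowing.asymptoticAverageShadowing
    (h : TwoSidedLimitShadowing f.toEquiv) : AsymptoticAverageShadowing f := by
  intro x hx
  obtain ⟨D, hD0, hD⟩ := exists_dist_bound X
  set α : ℕ → ℝ := fun l => dist (f (x l)) (x (l + 1)) with hαdef
  have hα : ∀ l, 0 ≤ α l := fun _ => dist_nonneg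
  have hpos : ∀ k : ℕ, (0 : ℝ) < 1 / ((k : ℝ) + 1) := fun k => Nat.one_div_pos_of_nat
  choose M hM using fun k : ℕ => h.chain_mixing (hpos k)
  set N : ℕ → ℕ := fun k => ∑ j ∈ Finset.range (k + 1), (M j + 1)
  have hNmono : Monotone N := fun i j hij =>
    Finset.sum_le_sum_of_subset (Finset.range_mono (by omega))
  have hMN : ∀ k, M k + 1 ≤ N k := fun k =>
    Finset.single_le_sum (f := fun j => M j + 1) (fun _ _ => Nat.zero_le _)
      (Finset.mem_range.2 k.lt_succ_self)
  set C : ℕ → ℝ := fun k => N k * (D / (1 / ((k : ℝ) + 1)))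
  have hCmono : Monotone C := fun i j hij => by
    refine mul_le_mul (by exact_mod_cast hNmono hij) ?_ (div_pos hD0 (hpos i)).le
      (Nat.cast_nonneg _)
    exact div_le_div_of_nonneg_left hD0.le (hpos j) (Nat.one_div_le_one_div hij)
  have hC0 : ∀ k, 0 < C k := fun k => by
    have : (0 : ℝ) < N k := by exact_mod_cast (Nat.succ_pos _).trans_le (hMN k)
    exact mul_pos this (div_pos hD0 (hpos k))
  obtain ⟨K, hKmono, hK, hKp⟩ := exists_slow_monotone
    (p := fun k n => N k ≤ n ∧ C k * ∑ l ∈ Finset.range (n + n), α l ≤ 1 / ((k : ℝ) + 1) * n) (by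
      intro k
      refine (eventually_ge_atTop (N k)).and ?_
      have hdouble : Tendsto (fun n : ℕ => n + n) atTop atTop :=
        tendsto_atTop_mono (fun n => Nat.le_add_left n n) tendsto_id
      have := (hx.comp hdouble).eventually
        (gt_mem_nhds (show 0 < 1 / ((k : ℝ) + 1) / (2 * C k) from
          div_pos (hpos k) (mul_pos two_pos (hC0 k))))
      filter_upwards [this, eventually_gt_atTop 0] with n hn hn0
      have hn0' : (0 : ℝ) < n := by exact_mod_cast hn0
      simp only [Function.comp, Nat.cast_add] at hn
      rw [div_lt_iff₀ (add_pos hn0' hn0')] at hn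
      have e := mul_le_mul_of_nonneg_left hn.le (hC0 k).le
      refine e.trans (le_of_eq ?_)
      have := (hC0 k).ne'
      field_simp
      ring)
  set T : ℕ → ℕ := fun j => (fun t => t + N (K t))^[j] 0
  have hTs : ∀ j, T (j + 1) = T j + N (K (T j)) := fun j => Function.iterate_succ_apply' _ _ _
  have hT : StrictMono T := strictMono_nat_of_lt_succ fun j => by
    have := hMN (K (T j))
    rw [hTs]
    omega
  have hT0 : T 0 = 0 := rfl
  have hlen : ∀ j, T (j + 1) - T j = N (K (T j)) := fun j => by
    rw [hTs, Nat.add_sub_cancel_left]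
  obtain ⟨x', hx'⟩ := exists_block_modification (g := f) hD hT hT0
    (η := fun j => 1 / ((K (T j) : ℝ) + 1)) (fun _ => hpos _)
    (fun j u v => by rw [hlen]; exact hM _ _ ((Nat.le_succ _).trans (hMN _)) u v) x
  obtain ⟨y, hy⟩ := h.forward x' (by
    refine Metric.tendsto_nhds.2 fun ε hε => ?_
    obtain ⟨k, hk⟩ := exists_nat_one_div_lt hε
    obtain ⟨J, hJ⟩ := eventually_atTop.1
      ((hK.comp hT.tendsto_atTop).eventually (eventually_ge_atTop k))
    filter_upwards [eventually_ge_atTop (T J)] with i hi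
    obtain ⟨j, hj, hj'⟩ := exists_block hT hT0 i
    have hJj : J ≤ j := Nat.lt_succ_iff.1 (hT.lt_iff_lt.1 (hi.trans_lt hj'))
    rw [Real.dist_0_eq_abs, abs_of_nonneg dist_nonneg]
    exact ((hx' j i hj hj').1.trans_le (Nat.one_div_le_one_div (hJ j hJj))).trans hk)
  have hmod : Tendsto (fun n : ℕ => (∑ i ∈ Finset.range n, dist (x' i) (x i)) / n) atTop (𝓝 0) := by
    refine squeeze_zero' (Eventually.of_forall fun n =>
      div_nonneg (Finset.sum_nonneg fun _ _ => dist_nonneg) (Nat.cast_nonneg n)) ?_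
      (tendsto_one_div_add_atTop_nhds_zero_nat.comp hK)
    filter_upwards [hKp, eventually_gt_atTop 0] with n ⟨hn, hn'⟩ hn0
    have hn0' : (0 : ℝ) < n := by exact_mod_cast hn0
    rw [div_le_iff₀ hn0']
    obtain ⟨j, hj, hj'⟩ := exists_block hT hT0 n
    have h2n : T (j + 1) ≤ n + n := by
      rw [hTs]
      exact add_le_add hj ((hNmono (hKmono hj)).trans hn)
    calc ∑ i ∈ Finset.range n, dist (x' i) (x i)
        ≤ ∑ i ∈ Finset.range (T (j + 1)), dist (x' i) (x i) :=
          sum_range_le_of_le (fun _ => dist_nonneg) hj'.le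
      _ ≤ C (K n) * ∑ l ∈ Finset.range (T (j + 1)), α l :=
          sum_range_block_le hT.monotone hT0
            (w := fun j => D / (1 / ((K (T j) : ℝ) + 1))) hα (j + 1)
            (fun i hi => by
              rw [hlen]
              exact hCmono (hKmono ((hT.monotone (Nat.lt_succ_iff.1 hi)).trans hj)))
            fun j i h₁ h₂ => (hx' j i h₁ h₂).2
      _ ≤ C (K n) * ∑ l ∈ Finset.range (n + n), α l :=
          mul_le_mul_of_nonneg_left (sum_range_le_of_le hα h2n) (hC0 _).le
      _ ≤ _ := hn'
  refine ⟨y, squeeze_zero (fun n => div_nonneg (Finset.sum_nonneg fun _ _ => dist_nonneg)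
    (Nat.cast_nonneg n)) (fun n => ?_) (by simpa using hy.cesaro.add hmod)⟩
  rw [← div_eq_inv_mul, ← add_div, ← Finset.sum_add_distrib]
  exact div_le_div_of_nonneg_right (Finset.sum_le_sum fun i _ => dist_triangle _ _ _)
    (Nat.cast_nonneg n)

end AverageShadowing

/-- A homeomorphism of a compact metric space with the two-sided limit shadowing
property is topologically mixing and has the specification, average shadowing and
asymptotic average shadowing properties. -/
theorem stmt7 [CompactSpace X] (f : X ≃ₜ X)
    (h : TwoSidedLimitShadowing f.toEquiv) :
    TopologicallyMixing ⇑f ∧ SpecificationProperty f.toEquiv ∧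
      AverageShadowing ⇑f ∧ AsymptoticAverageShadowing ⇑f :=
  ⟨h.specificationProperty.topologicallyMixing, h.specificationProperty,
    h.averageShadowing, h.asymptoticAverageShadowing⟩
end

section
/- Let (X,d) be a compact metric space and f : X → X an expansive homeomorphism. Then f is topologically transitive and has the shadowing property if and only if f has the two-sided limit shadowing property with a gap. -/
open Filter Topology

variable {X : Type*} [MetricSpace X]

/-- `f` is expansive, with some expansivity constant `ε > 0`. -/
def Expansive (f : X ≃ X) : Prop :=
  ∃ ε : ℝ, 0 < ε ∧ ∀ x y : X, (∀ n : ℤ, dist ((f ^ n) x) ((f ^ n) y) ≤ ε) → x = y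

/-- `g` is topologically transitive. -/
def TopologicallyTransitive (g : X → X) : Prop :=
  ∀ U V : Set X, IsOpen U → IsOpen V → U.Nonempty → V.Nonempty →
    ∃ N : ℕ, 0 < N ∧ (g^[N] '' U ∩ V).Nonempty

/-- The (two-sided) shadowing property for a bijection `f`. -/
def ShadowingPropertyZ (f : X ≃ X) : Prop :=
  ∀ ε : ℝ, 0 < ε → ∃ δ : ℝ, 0 < δ ∧ ∀ x : ℤ → X,
    (∀ i : ℤ, dist (f (x i)) (x (i + 1)) < δ) →
    ∃ y : X, ∀ i : ℤ, dist ((f ^ i) y) (x i) < ε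

/-- The sequence `x` is two-sided limit shadowed with gap `K`. -/
def TwoSidedLimitShadowedWithGap (f : X ≃ X) (x : ℤ → X) (K : ℤ) : Prop :=
  ∃ y : X,
    Tendsto (fun i : ℤ => dist ((f ^ i) y) (x i)) atBot (𝓝 0) ∧
    Tendsto (fun i : ℤ => dist ((f ^ (K + i)) y) (x i)) atTop (𝓝 0)

/-- `f` has the two-sided limit shadowing property with a gap. -/
def TwoSidedLimitShadowingWithGap (f : X ≃ X) : Prop :=
  ∃ N : ℕ, ∀ x : ℤ → X, IsTwoSidedLimitPseudoOrbit f x →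
    ∃ K : ℤ, |K| ≤ (N : ℤ) ∧ TwoSidedLimitShadowedWithGap f x K

theorem continuous_zpow_toEquiv (f : X ≃ₜ X) (n : ℤ) :
    Continuous ⇑((f.toEquiv : Equiv.Perm X) ^ n) := by
  induction n using Int.induction_on with
  | zero => simpa using continuous_id
  | succ n ih =>
    rw [zpow_add_one]
    exact ih.comp f.continuous
  | pred n ih =>
    rw [zpow_sub_one]
    exact ih.comp f.symm.continuous

theorem zpow_apply_succ {α : Type*} (g : Equiv.Perm α) (n : ℤ) (x : α) :
    (g ^ (n + 1)) x = g ((g ^ n) x) := by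
  rw [add_comm, zpow_add, zpow_one, Equiv.Perm.mul_apply]

/-- Shifts of an asymptotic pseudo-orbit converge to the orbit of the limit. -/
theorem tendsto_shift_zpow (f : X ≃ₜ X) {l : Filter ℤ}
    {u : Filter ℤ} (hu : u ≤ l) (hl : ∀ j : ℤ, Tendsto (fun i => i + j) l l) {z : ℤ → X}
    (hz : Tendsto (fun i : ℤ => dist (f (z i)) (z (i + 1))) l (𝓝 0))
    {b : X} (hb : Tendsto z u (𝓝 b)) (j : ℤ) :
    Tendsto (fun i => z (i + j)) u (𝓝 (((f.toEquiv : Equiv.Perm X) ^ j) b)) := by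
  have step (j : ℤ) : Tendsto (fun i : ℤ => dist (f (z (i + j))) (z (i + j + 1))) u (𝓝 0) :=
    (hz.comp (hl j)).mono_left hu
  induction j using Int.induction_on with
  | zero => simpa using hb
  | succ n ih =>
    have h := ((f.continuous.tendsto _).comp ih).congr_dist (step n)
    rw [zpow_apply_succ]
    simpa [add_assoc] using h
  | pred n ih =>
    have h := step (-n - 1)
    have e (i : ℤ) : i + (-(n : ℤ) - 1) + 1 = i + -n := by ring
    simp only [e] at h
    simp_rw [dist_comm] at h
    have h2 := ih.congr_dist h
    have h3 := (f.symm.continuous.tendsto _).comp h2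
    have h4 : f.symm (((f.toEquiv : Equiv.Perm X) ^ (-(n : ℤ))) b)
        = ((f.toEquiv : Equiv.Perm X) ^ (-(n : ℤ) - 1)) b := by
      rw [Homeomorph.symm_apply_eq]
      conv_lhs => rw [show -(n : ℤ) = (-n - 1) + 1 by ring, zpow_apply_succ]
      rfl
    rw [← h4]
    simpa [Function.comp_def] using h3

/-- Under expansivity, an orbit which eventually stays close to an asymptotic pseudo-orbit is
asymptotic to it. -/
theorem tendsto_dist_of_eventually_le [CompactSpace X] (f : X ≃ₜ X) {ε : ℝ}
    (hε : ∀ x y : X, (∀ n : ℤ, dist (((f.toEquiv : Equiv.Perm X) ^ n) x)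
      (((f.toEquiv : Equiv.Perm X) ^ n) y) ≤ ε) → x = y)
    {l : Filter ℤ} (hl : ∀ j : ℤ, Tendsto (fun i => i + j) l l) {z : ℤ → X}
    (hz : Tendsto (fun i : ℤ => dist (f (z i)) (z (i + 1))) l (𝓝 0)) (y : X)
    (hy : ∀ᶠ i in l, dist (((f.toEquiv : Equiv.Perm X) ^ i) y) (z i) ≤ ε) :
    Tendsto (fun i : ℤ => dist (((f.toEquiv : Equiv.Perm X) ^ i) y) (z i)) l (𝓝 0) := by
  rw [tendsto_iff_ultrafilter]
  intro u hu
  obtain ⟨a, -, ha⟩ := isCompact_univ.ultrafilter_le_nhds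
    (u.map fun i : ℤ => ((f.toEquiv : Equiv.Perm X) ^ i) y) (by simp)
  obtain ⟨b, -, hb⟩ := isCompact_univ.ultrafilter_le_nhds (u.map z) (by simp)
  have ha' : Tendsto (fun i : ℤ => ((f.toEquiv : Equiv.Perm X) ^ i) y) u (𝓝 a) := ha
  have hb' : Tendsto z u (𝓝 b) := hb
  have hab : a = b := by
    refine hε a b fun j => ?_
    have h0 : Tendsto (fun i : ℤ => dist (f (((f.toEquiv : Equiv.Perm X) ^ i) y))
        (((f.toEquiv : Equiv.Perm X) ^ (i + 1)) y)) l (𝓝 0) := by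
      refine tendsto_const_nhds.congr fun i => ?_
      rw [zpow_apply_succ]
      exact (dist_self _).symm
    exact le_of_tendsto ((tendsto_shift_zpow f hu hl h0 ha' j).dist
      (tendsto_shift_zpow f hu hl hz hb' j)) (hu ((hl j).eventually hy))
  simpa [hab] using ha'.dist hb'

/-- Transition times of a transitive map on a compact space are bounded, up to an error `δ`. -/
theorem TopologicallyTransitive.exists_bound [CompactSpace X] {g : X → X}
    (hg : TopologicallyTransitive g) {δ : ℝ} (hδ : 0 < δ) :
    ∃ N : ℕ, ∀ a b : X, ∃ z : X, ∃ k : ℕ, 0 < k ∧ k ≤ N ∧ dist a z < δ ∧ dist (g^[k] z) b < δ := by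
  obtain ⟨t, -, ht⟩ := isCompact_univ.elim_nhds_subcover (fun x : X => Metric.ball x (δ / 2))
    fun x _ => Metric.ball_mem_nhds x (half_pos hδ)
  choose n hn h using fun p : X × X => hg (Metric.ball p.1 (δ / 2)) (Metric.ball p.2 (δ / 2))
    Metric.isOpen_ball Metric.isOpen_ball ⟨p.1, Metric.mem_ball_self (half_pos hδ)⟩
    ⟨p.2, Metric.mem_ball_self (half_pos hδ)⟩
  refine ⟨(t ×ˢ t).sup n, fun a b => ?_⟩
  obtain ⟨p, hp, hap⟩ := Set.mem_iUnion₂.1 (ht (Set.mem_univ a))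
  obtain ⟨q, hq, hbq⟩ := Set.mem_iUnion₂.1 (ht (Set.mem_univ b))
  obtain ⟨_, ⟨z, hz, rfl⟩, hzq⟩ := h (p, q)
  simp only [Metric.mem_ball] at *
  refine ⟨z, n (p, q), hn _, Finset.le_sup (f := n) (Finset.mk_mem_product hp hq), ?_, ?_⟩
  · linarith [dist_triangle_right a z p]
  · linarith [dist_triangle_right (g^[n (p, q)] z) b q]

theorem twoSidedLimitShadowingWithGap_of_transitive_of_shadowing [CompactSpace X] (f : X ≃ₜ X)
    (he : Expansive f.toEquiv) (ht : TopologicallyTransitive f)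
    (hs : ShadowingPropertyZ f.toEquiv) : TwoSidedLimitShadowingWithGap f.toEquiv := by
  obtain ⟨ε, hε, hexp⟩ := he
  obtain ⟨δ, hδ, hsh⟩ := hs ε hε
  obtain ⟨N, hN⟩ := ht.exists_bound hδ
  refine ⟨N, fun x hx => ?_⟩
  rw [IsTwoSidedLimitPseudoOrbit, Int.cofinite_eq, tendsto_sup] at hx
  obtain ⟨hbot, htop⟩ := hx
  obtain ⟨A, hA⟩ := eventually_atBot.1 (hbot.eventually_lt_const hδ)
  obtain ⟨B, hB⟩ := eventually_atTop.1 (htop.eventually_lt_const hδ)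
  obtain ⟨C, hAC, hBC⟩ : ∃ C : ℤ, A < C ∧ B ≤ C := ⟨max (A + 1) B, by grind, by grind⟩
  set g : Equiv.Perm X := f.toEquiv
  obtain ⟨z, k, hk, hkN, hz, hzk⟩ := hN ((g ^ (C - A)) (x A)) (x C)
  have hzk' : dist ((g ^ (k : ℤ)) z) (x C) < δ := by
    rw [zpow_natCast, ← Equiv.Perm.iterate_eq_pow]
    exact hzk
  let w : ℤ → X := fun i => if i < A then x i else if i < C then (g ^ (i - A)) (x A) else
    if i < C + k then (g ^ (i - C)) z else x (i - k)
  have hw (i : ℤ) : dist (g (w i)) (w (i + 1)) < δ := by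
    rcases lt_or_ge i A with h1 | h1
    · have e : w i = x i := if_pos h1
      have e' : w (i + 1) = x (i + 1) := by
        rcases (show i + 1 ≤ A by omega).lt_or_eq with h2 | h2
        · exact if_pos h2
        · simp [w, h2, hAC]
      rw [e, e']
      exact hA i h1.le
    rcases lt_or_ge i C with h2 | h2
    · have e : g (w i) = (g ^ (i + 1 - A)) (x A) := by
        simp only [w, if_neg h1.not_gt, if_pos h2]
        rw [← zpow_apply_succ, add_sub_right_comm]
      rw [e]
      rcases (show i + 1 ≤ C by omega).lt_or_eq with h3 | h3
      · simp only [w, if_pos h3, if_neg (show ¬ i + 1 < A by omega), dist_self, hδ]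
      · have e' : w (i + 1) = z := by
          simp [w, h3, hAC.not_gt, hk]
        rw [e', h3]
        exact hz
    rcases lt_or_ge i (C + k) with h3 | h3
    · have e : g (w i) = (g ^ (i + 1 - C)) z := by
        simp only [w, if_neg h1.not_gt, if_neg h2.not_gt, if_pos h3]
        rw [← zpow_apply_succ, add_sub_right_comm]
      rw [e]
      rcases (show i + 1 ≤ C + k by omega).lt_or_eq with h4 | h4
      · simp only [w, if_neg (show ¬ i + 1 < A by omega), if_neg (show ¬ i + 1 < C by omega),
          if_pos h4, dist_self, hδ]
      · have e' : w (i + 1) = x C := by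
          simp only [w, if_neg (show ¬ i + 1 < A by omega), if_neg (show ¬ i + 1 < C by omega),
            if_neg (show ¬ i + 1 < C + k by omega)]
          congr 1
          omega
        rw [e', show i + 1 - C = k by omega]
        exact hzk'
    · simp only [w, if_neg (show ¬ i < A by omega), if_neg (show ¬ i < C by omega),
        if_neg (show ¬ i < C + k by omega), if_neg (show ¬ i + 1 < A by omega),
        if_neg (show ¬ i + 1 < C by omega), if_neg (show ¬ i + 1 < C + k by omega)]
      rw [add_sub_right_comm]
      exact hB _ (by omega)
  obtain ⟨y, hy⟩ := hsh w hw
  refine ⟨k, by rw [abs_of_nonneg (by positivity)]; exact_mod_cast hkN, y, ?_, ?_⟩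
  · refine tendsto_dist_of_eventually_le f hexp (fun j => tendsto_atBot_add_const_right _ j tendsto_id)
      hbot y ?_
    filter_upwards [eventually_lt_atBot A] with i hi
    have := (hy i).le
    rwa [show w i = x i from if_pos hi] at this
  · have key := tendsto_dist_of_eventually_le f hexp
      (fun j => tendsto_atTop_add_const_right _ j tendsto_id) htop ((g ^ (k : ℤ)) y) ?_
    · refine key.congr fun i => ?_
      rw [add_comm, zpow_add]
      rfl
    filter_upwards [eventually_ge_atTop C] with i hi
    have := (hy (i + k)).le
    rw [show w (i + k) = x i by
      simp only [w, if_neg (show ¬ i + k < A by omega), if_neg (show ¬ i + k < C by omega),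
        if_neg (show ¬ i + k < C + k by omega), add_sub_cancel_right], zpow_add] at this
    exact this

theorem transGen_of_dist_zpow_lt (g : Equiv.Perm X) {δ : ℝ} (hδ : 0 < δ) {a b : X} {n : ℤ}
    (hn : 0 < n) (h : dist ((g ^ n) a) b < δ) :
    Relation.TransGen (fun x y => dist (g x) y < δ) a b := by
  induction n, Int.add_one_le_iff.2 hn using Int.leInduction generalizing b with
  | base => exact .single (by simpa using h)
  | succ n hn ih =>
    refine .tail (ih (b := (g ^ n) a) (by omega) (by simpa using hδ)) ?_
    rwa [← zpow_apply_succ]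

/-- A chain can be prolonged to reach any point accessible from its end. -/
theorem exists_chain_extension {α : Type*} {r : α → α → Prop} {c : ℕ → α} {l : ℕ}
    (hc : ∀ i < l, r (c i) (c (i + 1))) {b : α} (hb : Relation.TransGen r (c l) b) :
    ∃ (d : ℕ → α) (m : ℕ), l < m ∧ (∀ i ≤ l, d i = c i) ∧ d m = b ∧
      ∀ i < m, r (d i) (d (i + 1)) := by
  induction hb with
  | @single b h =>
    refine ⟨fun i => if i ≤ l then c i else b, l + 1, by omega, fun i hi => if_pos hi,
      by simp, fun i hi => ?_⟩
    rcases (Nat.lt_succ_iff.1 hi).lt_or_eq with h1 | rfl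
    · simpa [h1.le, Nat.succ_le_of_lt h1] using hc i h1
    · simpa using h
  | @tail p b _ h ih =>
    obtain ⟨d, m, hm, hd, rfl, hr⟩ := ih
    refine ⟨fun i => if i ≤ m then d i else b, m + 1, by omega, fun i hi => ?_,
      by simp, fun i hi => ?_⟩
    · simpa [hi.trans hm.le] using hd i hi
    rcases (Nat.lt_succ_iff.1 hi).lt_or_eq with h1 | rfl
    · simpa [h1.le, Nat.succ_le_of_lt h1] using hr i h1
    · simpa using h

/-- Concatenation of infinitely many chains. -/
theorem exists_concatenation {α : Type*} {r : ℕ → α → α → Prop} (c : ℕ → ℕ → α) (m : ℕ → ℕ)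
    (hm : ∀ n, 0 < m n) (hc : ∀ n, ∀ i < m n, r n (c n i) (c n (i + 1)))
    (hcc : ∀ n, c n (m n) = c (n + 1) 0) :
    ∃ (z : ℕ → α) (s : ℕ → ℕ), StrictMono s ∧ (∀ n, ∀ i < m n, z (s n + i) = c n i) ∧
      ∀ n, ∀ k ≥ s n, ∃ n' ≥ n, r n' (z k) (z (k + 1)) := by
  let s : ℕ → ℕ := fun n => ∑ j ∈ Finset.range n, m j
  have hs (n : ℕ) : s (n + 1) = s n + m n := Finset.sum_range_succ _ _
  have hmono : StrictMono s := strictMono_nat_of_lt_succ fun n => by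
    have := hm n
    rw [hs]
    omega
  have hex (k : ℕ) : ∃ n, s n ≤ k ∧ k < s (n + 1) := by
    induction k with
    | zero => exact ⟨0, by simp [s], by rw [hs]; have := hm 0; omega⟩
    | succ k ih =>
      obtain ⟨n, h1, h2⟩ := ih
      rcases (Nat.succ_le_of_lt h2).lt_or_eq with h | h
      · exact ⟨n, by omega, h⟩
      · exact ⟨n + 1, h.ge, by rw [hs (n + 1)]; have := hm (n + 1); omega⟩
  choose ν hν1 hν2 using hex
  have huniq (n k : ℕ) (h1 : s n ≤ k) (h2 : k < s (n + 1)) : ν k = n := by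
    have h3 := hmono.lt_iff_lt.1 (h1.trans_lt (hν2 k))
    have h4 := hmono.lt_iff_lt.1 ((hν1 k).trans_lt h2)
    omega
  have hz (n i : ℕ) (hi : i < m n) : c (ν (s n + i)) (s n + i - s (ν (s n + i))) = c n i := by
    rw [huniq n (s n + i) (by omega) (by rw [hs]; omega), Nat.add_sub_cancel_left]
  refine ⟨fun k => c (ν k) (k - s (ν k)), s, hmono, hz, fun n k hk => ⟨ν k, ?_, ?_⟩⟩
  · have := hmono.lt_iff_lt.1 (hk.trans_lt (hν2 k))
    omega
  · have h1 := hν1 k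
    have h2 := hν2 k
    rw [hs] at h2
    have hr := hc (ν k) (k - s (ν k)) (by omega)
    rcases (show k + 1 ≤ s (ν k) + m (ν k) by omega).lt_or_eq with h3 | h3
    · have := huniq (ν k) (k + 1) (by omega) (by rw [hs]; omega)
      simp only [this]
      rwa [show k + 1 - s (ν k) = k - s (ν k) + 1 by omega]
    · have := hz (ν k + 1) 0 (hm _)
      rw [hs, add_zero, ← h3] at this
      simp only [this]
      rwa [← hcc, show m (ν k) = k - s (ν k) + 1 by omega]

/-- Two-sided limit shadowing with a gap implies chain transitivity. -/
theorem TwoSidedLimitShadowingWithGap.transGen [CompactSpace X] {f : X ≃ₜ X}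
    (hf : TwoSidedLimitShadowingWithGap f.toEquiv) {δ : ℝ} (hδ : 0 < δ) (a b : X) :
    Relation.TransGen (fun x y => dist (f x) y < δ) a b := by
  obtain ⟨N, hN⟩ := hf
  set g : Equiv.Perm X := f.toEquiv
  have hgc (n : ℤ) : Continuous ⇑(g ^ n) := continuous_zpow_toEquiv f n
  let U : Ultrafilter ℕ := hyperfilter ℕ
  have hU : (U : Filter ℕ) ≤ atTop := Nat.hyperfilter_le_atTop
  obtain ⟨p, -, hp⟩ := isCompact_univ.ultrafilter_le_nhds
    (U.map fun n : ℕ => (g ^ (n : ℤ)) a) (by simp)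
  obtain ⟨q, -, hq⟩ := isCompact_univ.ultrafilter_le_nhds
    (U.map fun n : ℕ => (g ^ (-n : ℤ)) b) (by simp)
  replace hp : Tendsto (fun n : ℕ => (g ^ (n : ℤ)) a) U (𝓝 p) := hp
  replace hq : Tendsto (fun n : ℕ => (g ^ (-n : ℤ)) b) U (𝓝 q) := hq
  have hclose {h : ℕ → X} {c : X} (hh : Tendsto h U (𝓝 c)) (j k : ℤ) :
      ∃ n : ℕ, k < n ∧ dist ((g ^ j) (h n)) ((g ^ j) c) < δ / 2 := by
    have h1 : ∀ᶠ n in (U : Filter ℕ), dist ((g ^ j) (h n)) ((g ^ j) c) < δ / 2 :=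
      (((hgc j).tendsto c).comp hh).eventually (Metric.ball_mem_nhds _ (half_pos hδ))
    have h2 : ∀ᶠ n : ℕ in (U : Filter ℕ), k < n :=
      hU ((tendsto_natCast_atTop_atTop (R := ℤ)).eventually_gt_atTop k)
    exact (h2.and h1).exists
  obtain ⟨K, -, y, hy1, hy2⟩ := hN (fun i => if i < 0 then (g ^ i) p else (g ^ i) q) <| by
    refine tendsto_const_nhds.congr' ?_
    filter_upwards [(Set.finite_singleton (-1 : ℤ)).compl_mem_cofinite] with i hi
    have hi : i ≠ -1 := hi
    by_cases h : i < 0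
    · rw [if_pos h, if_pos (by omega), zpow_apply_succ, dist_self]
    · rw [if_neg h, if_neg (by omega), zpow_apply_succ, dist_self]
  obtain ⟨i, hi, hi0⟩ := ((hy1.eventually_lt_const (half_pos hδ)).and
    (eventually_lt_atBot 0)).exists
  obtain ⟨j, hj, hj0⟩ := ((hy2.eventually_lt_const (half_pos hδ)).and
    (eventually_gt_atTop (max 0 (i - K)))).exists
  rw [max_lt_iff] at hj0
  beta_reduce at hi hj
  rw [if_pos hi0] at hi
  rw [if_neg (by omega)] at hj
  obtain ⟨n, hn, hnp⟩ := hclose hp i (-i)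
  obtain ⟨m, hm, hmq⟩ := hclose hq j j
  rw [← Equiv.Perm.mul_apply, ← zpow_add] at hnp
  rw [← Equiv.Perm.mul_apply, ← zpow_add] at hmq
  refine ((transGen_of_dist_zpow_lt g hδ (n := i + n) (b := (g ^ i) y) (by omega) ?_).trans
    (transGen_of_dist_zpow_lt g hδ (n := K + j - i) (b := (g ^ (j + -m)) b) (by omega) ?_)).trans
    (transGen_of_dist_zpow_lt g hδ (n := m - j) (by omega) ?_)
  · linarith [dist_triangle_right ((g ^ (i + n : ℤ)) a) ((g ^ i) y) ((g ^ i) p)]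
  · rw [← Equiv.Perm.mul_apply, ← zpow_add, sub_add_cancel]
    linarith [dist_triangle_right ((g ^ (K + j)) y) ((g ^ (j + -m : ℤ)) b) ((g ^ j) q)]
  · rw [← Equiv.Perm.mul_apply, ← zpow_add, show (m : ℤ) - j + (j + -m) = 0 by ring]
    simpa using hδ

/-- Two-sided limit shadowing with a gap implies shadowing of finite chains. -/
theorem TwoSidedLimitShadowingWithGap.exists_shadow_chain [CompactSpace X] {f : X ≃ₜ X}
    (hf : TwoSidedLimitShadowingWithGap f.toEquiv) {ε : ℝ} (hε : 0 < ε) :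
    ∃ δ > 0, ∀ (c : ℕ → X) (l : ℕ), (∀ i < l, dist (f (c i)) (c (i + 1)) < δ) →
      ∃ y : X, ∀ i ≤ l, dist (((f.toEquiv : Equiv.Perm X) ^ (i : ℤ)) y) (c i) < ε := by
  by_contra! hcon
  have hpos (n : ℕ) : (0 : ℝ) < 1 / (n + 1) := Nat.one_div_pos_of_nat
  choose c l hc hbad using fun n : ℕ => hcon (1 / (n + 1)) (hpos n)
  choose d m hm hdc hdm hd using fun n : ℕ =>
    exists_chain_extension (hc n) (hf.transGen (hpos n) (c n (l n)) (c (n + 1) 0))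
  obtain ⟨z, s, hs, hzs, hz⟩ := exists_concatenation
    (r := fun n x y => dist (f x) y < 1 / ((n : ℝ) + 1)) d m (fun n => by have := hm n; omega) hd
    fun n => by rw [hdm, hdc _ _ (Nat.zero_le _)]
  set g : Equiv.Perm X := f.toEquiv
  obtain ⟨N, hN⟩ := hf
  obtain ⟨K, -, y, -, hy⟩ := hN (fun i => if i < 0 then (g ^ i) (z 0) else z i.toNat) <| by
    rw [IsTwoSidedLimitPseudoOrbit, Int.cofinite_eq, tendsto_sup]
    constructor
    · refine tendsto_const_nhds.congr' ?_
      filter_upwards [eventually_lt_atBot (-1)] with i hi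
      rw [if_pos (by omega), if_pos (by omega), zpow_apply_succ, dist_self]
    · rw [Metric.tendsto_atTop]
      intro η hη
      obtain ⟨n, hn⟩ := exists_nat_one_div_lt hη
      refine ⟨s n, fun i hi => ?_⟩
      lift i to ℕ using by omega
      obtain ⟨n', hn', h⟩ := hz n i (by exact_mod_cast hi)
      rw [if_neg (by omega), if_neg (by omega), Real.dist_0_eq_abs, abs_of_nonneg dist_nonneg]
      refine lt_trans ?_ hn
      exact lt_of_lt_of_le h (Nat.one_div_le_one_div hn')
  obtain ⟨T, hT⟩ := eventually_atTop.1 (hy.eventually_lt_const hε)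
  obtain ⟨i, hi, hi2⟩ := hbad T.toNat ((g ^ (K + s T.toNat)) y)
  have h1 := hT (s T.toNat + i) (by have := hs.id_le T.toNat; simp only [id] at this; omega)
  beta_reduce at h1
  rw [if_neg (by omega), show ((s T.toNat : ℤ) + i).toNat = s T.toNat + i by omega,
    hzs _ _ (hi.trans_lt (hm _)), hdc _ _ hi] at h1
  rw [← Equiv.Perm.mul_apply, ← zpow_add,
    show (i : ℤ) + (K + s T.toNat) = K + (s T.toNat + i) by ring] at hi2
  exact absurd h1 hi2.not_gt

theorem TwoSidedLimitShadowingWithGap.shadowingPropertyZ [CompactSpace X] {f : X ≃ₜ X}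
    (hf : TwoSidedLimitShadowingWithGap f.toEquiv) : ShadowingPropertyZ f.toEquiv := by
  intro ε hε
  obtain ⟨δ, hδ, h⟩ := hf.exists_shadow_chain (half_pos hε)
  refine ⟨δ, hδ, fun x hx => ?_⟩
  set g : Equiv.Perm X := f.toEquiv
  choose y hy using fun n : ℕ => h (fun i => x (i - n)) (2 * n) fun i _ => by
    have := hx (i - n)
    rwa [show (i : ℤ) - n + 1 = (i + 1 : ℕ) - n by push_cast; ring] at this
  let U : Ultrafilter ℕ := hyperfilter ℕ
  have hU : (U : Filter ℕ) ≤ atTop := Nat.hyperfilter_le_atTop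
  obtain ⟨p, -, hp⟩ := isCompact_univ.ultrafilter_le_nhds
    (U.map fun n : ℕ => (g ^ (n : ℤ)) (y n)) (by simp)
  replace hp : Tendsto (fun n : ℕ => (g ^ (n : ℤ)) (y n)) U (𝓝 p) := hp
  refine ⟨p, fun i => lt_of_le_of_lt ?_ (half_lt_self hε)⟩
  refine le_of_tendsto ((((continuous_zpow_toEquiv f i).tendsto p).comp hp).dist
    tendsto_const_nhds) (hU ?_)
  filter_upwards [eventually_ge_atTop i.natAbs] with n hn
  have := (hy n (i + n).toNat (by omega)).le
  rw [show ((i + n).toNat : ℤ) = i + n by omega, zpow_add, add_sub_cancel_right] at this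
  exact this

theorem TwoSidedLimitShadowingWithGap.topologicallyTransitive [CompactSpace X] {f : X ≃ₜ X}
    (hf : TwoSidedLimitShadowingWithGap f.toEquiv) : TopologicallyTransitive f := by
  rintro U V hU hV ⟨u, hu⟩ ⟨v, hv⟩
  obtain ⟨ε₁, hε₁, h₁⟩ := Metric.isOpen_iff.1 hU u hu
  obtain ⟨ε₂, hε₂, h₂⟩ := Metric.isOpen_iff.1 hV v hv
  obtain ⟨δ, hδ, h⟩ := hf.exists_shadow_chain (lt_min hε₁ hε₂)
  obtain ⟨d, m, hm, hd0, rfl, hd⟩ := exists_chain_extension (c := fun _ => u) (l := 0)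
    (by simp) (hf.transGen hδ u v)
  obtain ⟨y, hy⟩ := h d m hd
  refine ⟨m, hm, f^[m] y, ⟨y, h₁ ?_, rfl⟩, h₂ ?_⟩
  · have := (hy 0 (Nat.zero_le _)).trans_le (min_le_left _ _)
    simpa [hd0] using this
  · have := (hy m le_rfl).trans_le (min_le_right _ _)
    rw [zpow_natCast, ← Equiv.Perm.iterate_eq_pow] at this
    exact this

/-- An expansive homeomorphism of a compact metric space is topologically transitive
with the shadowing property if and only if it has the two-sided limit shadowing
property with a gap. -/
theorem stmt13 [CompactSpace X] (f : X ≃ₜ X) (he : Expansive f.toEquiv) :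
    (TopologicallyTransitive ⇑f ∧ ShadowingPropertyZ f.toEquiv) ↔
      TwoSidedLimitShadowingWithGap f.toEquiv :=
  ⟨fun h => twoSidedLimitShadowingWithGap_of_transitive_of_shadowing f he h.1 h.2,
    fun h => ⟨h.topologicallyTransitive, h.shadowingPropertyZ⟩⟩
end

section
/- Let A be a finite nonempty set with the discrete topology, let Ω = A^ℤ carry the product topology metrized by D(x,y) = sup_{j∈ℤ} 2^{−|j|}·ρ(x_j,y_j) where ρ is the discrete metric on A, and let σ : Ω → Ω be the shift σ((x_n)_{n∈ℤ}) = (x_{n+1})_{n∈ℤ}. Let X ⊆ Ω be a nonempty closed σ-invariant subset (a shift space) and consider σ restricted to X. Then X is a topologically transitive shift of finite type if and only if σ|X has the two-sided limit shadowing property with a gap. -/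
open Filter Topology

/-- The shift map on `A^ℤ`, as a bijection. -/
def shiftMap {A : Type*} : (ℤ → A) ≃ (ℤ → A) where
  toFun x n := x (n + 1)
  invFun x n := x (n - 1)
  left_inv x := funext fun n => by simp
  right_inv x := funext fun n => by simp

/-- The metric `D(x,y) = sup_j 2^{-|j|} ρ(x_j, y_j)`, where `ρ` is the discrete
metric on `A`. -/
noncomputable def shiftDist {A : Type*} [DecidableEq A] (x y : ℤ → A) : ℝ :=
  ⨆ j : ℤ, (2 : ℝ) ^ (-|j|) * (if x j = y j then 0 else 1)

/-- `X` is a shift of finite type: membership in `X` is determined by a set `𝓛` of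
admissible words of length `N + 1`. -/
def IsShiftOfFiniteType {A : Type*} (X : Set (ℤ → A)) : Prop :=
  ∃ N : ℕ, ∃ 𝓛 : Set (Fin (N + 1) → A),
    ∀ x : ℤ → A, x ∈ X ↔ ∀ j : ℤ, (fun k : Fin (N + 1) => x (j + (k : ℕ))) ∈ 𝓛

/-- The restriction of the shift to `X` is topologically transitive (open sets of the
subspace `X` are realized as intersections of ambient open sets with `X`). -/
def ShiftTransitiveOn {A : Type*} [TopologicalSpace A] (X : Set (ℤ → A)) : Prop :=
  ∀ U V : Set (ℤ → A), IsOpen U → IsOpen V →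
    (U ∩ X).Nonempty → (V ∩ X).Nonempty →
    ∃ N : ℕ, 0 < N ∧ ((⇑(shiftMap ^ N) '' (U ∩ X)) ∩ (V ∩ X)).Nonempty

/-- The restriction of the shift to `X` has the two-sided limit shadowing property
with a gap, with respect to the metric `shiftDist`. -/
def ShiftTwoSidedLimitShadowingWithGapOn {A : Type*} [DecidableEq A]
    (X : Set (ℤ → A)) : Prop :=
  ∃ N : ℕ, ∀ x : ℤ → (ℤ → A), (∀ i : ℤ, x i ∈ X) →
    Tendsto (fun i : ℤ => shiftDist (shiftMap (x i)) (x (i + 1))) cofinite (𝓝 0) →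
    ∃ K : ℤ, |K| ≤ (N : ℤ) ∧ ∃ y ∈ X,
      Tendsto (fun i : ℤ => shiftDist ((shiftMap ^ i) y) (x i)) atBot (𝓝 0) ∧
      Tendsto (fun i : ℤ => shiftDist ((shiftMap ^ (K + i)) y) (x i)) atTop (𝓝 0)

/-! ### The shift and its metric -/

lemma shiftMap_pow_apply {A : Type*} (n : ℕ) (x : ℤ → A) (j : ℤ) :
    (shiftMap ^ n) x j = x (j + n) := by
  induction n generalizing x with
  | zero => simp
  | succ n ih =>
    rw [pow_succ, Equiv.Perm.mul_apply, ih]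
    simp [shiftMap, add_assoc]

lemma shiftMap_zpow_apply {A : Type*} (k : ℤ) (x : ℤ → A) (j : ℤ) :
    (shiftMap ^ k) x j = x (j + k) := by
  obtain ⟨n, rfl | rfl⟩ := k.eq_nat_or_neg
  · rw [zpow_natCast, shiftMap_pow_apply]
  · have h := shiftMap_pow_apply n ((shiftMap ^ (-(n : ℤ))) x) (j + -(n : ℤ))
    rw [← zpow_natCast, ← Equiv.Perm.mul_apply, ← zpow_add] at h
    simpa using h.symm

lemma translate_mem {A : Type*} {X : Set (ℤ → A)} (hinv : ⇑shiftMap '' X = X)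
    {x : ℤ → A} (hx : x ∈ X) (k : ℤ) : (fun j => x (j + k)) ∈ X := by
  have succ : ∀ z : ℤ → A, z ∈ X → (fun j => z (j + 1)) ∈ X := fun z hz =>
    hinv ▸ Set.mem_image_of_mem _ hz
  have pred : ∀ z : ℤ → A, z ∈ X → (fun j => z (j - 1)) ∈ X := by
    intro z hz
    obtain ⟨w, hw, rfl⟩ := hinv.symm ▸ hz
    simpa [shiftMap] using hw
  induction k with
  | zero => simpa using hx
  | succ n ih =>
    convert succ _ ih using 2
    ring_nf
  | pred n ih =>
    convert pred _ ih using 2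
    ring_nf

lemma tendsto_shiftDist_zero_iff {A ι : Type*} [DecidableEq A] {l : Filter ι}
    {f g : ι → ℤ → A} :
    Tendsto (fun i => shiftDist (f i) (g i)) l (𝓝 0) ↔ ∀ j, ∀ᶠ i in l, f i j = g i j := by
  have term_nonneg : ∀ (x y : ℤ → A) (j : ℤ),
      (0 : ℝ) ≤ (2 : ℝ) ^ (-|j|) * (if x j = y j then 0 else 1) := fun x y j => by
    split_ifs <;> simp
    positivity
  have term_le : ∀ (x y : ℤ → A) (j : ℤ),
      (2 : ℝ) ^ (-|j|) * (if x j = y j then 0 else 1) ≤ (2 : ℝ) ^ (-|j|) := fun x y j => by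
    split_ifs <;> simp
    positivity
  have le_one : ∀ j : ℤ, (2 : ℝ) ^ (-|j|) ≤ 1 := fun j =>
    zpow_le_one_of_nonpos₀ (by norm_num) (by simp)
  have bdd : ∀ x y : ℤ → A, BddAbove (Set.range fun j : ℤ =>
      (2 : ℝ) ^ (-|j|) * (if x j = y j then 0 else 1)) := by
    rintro x y
    refine ⟨1, ?_⟩
    rintro _ ⟨j, rfl⟩
    exact (term_le x y j).trans (le_one j)
  constructor
  · intro h j
    filter_upwards [h.eventually (gt_mem_nhds (show (0 : ℝ) < 2 ^ (-|j|) by positivity))]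
      with i hi
    by_contra hne
    have := le_ciSup (bdd (f i) (g i)) j
    simp only [if_neg hne, mul_one] at this
    exact absurd hi (not_lt.mpr this)
  · intro h
    rw [Metric.tendsto_nhds]
    intro ε hε
    obtain ⟨m, hm⟩ := exists_pow_lt_of_lt_one hε (show (1 / 2 : ℝ) < 1 by norm_num)
    have hfin := (Set.finite_Icc (-(m : ℤ)) m).eventually_all (l := l) |>.mpr
      (fun j _ => h j)
    filter_upwards [hfin] with i hi
    have h0 : 0 ≤ shiftDist (f i) (g i) := Real.iSup_nonneg (term_nonneg _ _)
    rw [Real.dist_eq, sub_zero, abs_of_nonneg h0]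
    refine lt_of_le_of_lt (ciSup_le fun j => ?_) hm
    by_cases hj : j ∈ Set.Icc (-(m : ℤ)) m
    · rw [if_pos (hi j hj)]
      simp
    · refine (term_le _ _ j).trans ?_
      have hj' : (m : ℤ) ≤ |j| := by
        rw [Set.mem_Icc, ← abs_le] at hj
        omega
      rw [one_div, inv_pow, ← zpow_natCast, ← zpow_neg]
      exact zpow_le_zpow_right₀ (by norm_num) (by omega)

/-! ### Asymptotically admissible sequences -/

/-- For every radius `m`, all but finitely many windows of radius `m` of `s` occur in `X`. -/
def AsympAdmissible {A : Type*} (X : Set (ℤ → A)) (s : ℤ → A) : Prop :=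
  ∀ m : ℕ, ∀ᶠ i : ℤ in cofinite, ∃ x ∈ X, ∀ j, |j - i| ≤ m → s j = x j

/-- Symbolic form of two-sided limit shadowing with a gap bounded by `N`. -/
def SymbolicShadowing {A : Type*} (X : Set (ℤ → A)) (N : ℕ) : Prop :=
  ∀ s, AsympAdmissible X s → ∃ K : ℤ, |K| ≤ (N : ℤ) ∧ ∃ y ∈ X,
    (∀ᶠ i in atBot, y i = s i) ∧ ∀ᶠ i in atTop, y (K + i) = s i

lemma exists_best_window {A : Type*} {X : Set (ℤ → A)} (hne : X.Nonempty) (s : ℤ → A)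
    (i : ℤ) (b : ℕ) : ∃ x ∈ X, ∀ m ≤ b,
      (∃ z ∈ X, ∀ j, |j - i| ≤ (m : ℤ) → s j = z j) → ∀ j, |j - i| ≤ (m : ℤ) → s j = x j := by
  classical
  induction b with
  | zero =>
    by_cases h : ∃ z ∈ X, ∀ j, |j - i| ≤ ((0 : ℕ) : ℤ) → s j = z j
    · obtain ⟨z, hz, hs⟩ := h
      refine ⟨z, hz, fun m hm _ => ?_⟩
      obtain rfl : m = 0 := by omega
      exact hs
    · obtain ⟨x, hx⟩ := hne
      refine ⟨x, hx, fun m hm h' => ?_⟩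
      obtain rfl : m = 0 := by omega
      exact absurd h' h
  | succ b ih =>
    by_cases h : ∃ z ∈ X, ∀ j, |j - i| ≤ ((b + 1 : ℕ) : ℤ) → s j = z j
    · obtain ⟨z, hz, hs⟩ := h
      exact ⟨z, hz, fun m hm _ j hj => hs j (by omega)⟩
    · obtain ⟨x, hx, hxs⟩ := ih
      refine ⟨x, hx, fun m hm h' => ?_⟩
      rcases Nat.lt_or_ge b m with hbm | hbm
      · obtain rfl : m = b + 1 := by omega
        exact absurd h' h
      · exact hxs m hbm h'

lemma exists_approximating_points {A : Type*} {X : Set (ℤ → A)} (hne : X.Nonempty)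
    {s : ℤ → A} (hs : AsympAdmissible X s) : ∃ x : ℤ → ℤ → A, (∀ i, x i ∈ X) ∧
      ∀ j, ∀ᶠ i in cofinite, x i (i + j) = s (i + j) := by
  choose x hx hxs using fun i : ℤ => exists_best_window hne s i i.natAbs
  refine ⟨x, hx, fun j => ?_⟩
  have hfin : ∀ᶠ i : ℤ in cofinite, j.natAbs ≤ i.natAbs := by
    refine (Set.finite_Icc (-|j|) |j|).subset fun i hi => ?_
    have hij : i.natAbs < j.natAbs := not_le.mp hi
    rw [Set.mem_Icc, ← abs_le, ← Int.natCast_natAbs i, ← Int.natCast_natAbs j]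
    exact_mod_cast hij.le
  filter_upwards [hs j.natAbs, hfin] with i hi hij
  refine (hxs i _ hij hi (i + j) ?_).symm
  simp

lemma symbolicShadowing_of_gap {A : Type*} [DecidableEq A] {X : Set (ℤ → A)}
    (hne : X.Nonempty) (hinv : ⇑shiftMap '' X = X)
    (h : ShiftTwoSidedLimitShadowingWithGapOn X) : ∃ N, SymbolicShadowing X N := by
  obtain ⟨N, h⟩ := h
  refine ⟨N, fun s hs => ?_⟩
  obtain ⟨x, hx, hxs⟩ := exists_approximating_points hne hs
  obtain ⟨K, hK, y, hy, hbot, htop⟩ := h (fun i j => x i (j + i))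
    (fun i => translate_mem hinv (hx i) i) (by
      refine tendsto_shiftDist_zero_iff.mpr fun j => ?_
      filter_upwards [hxs (j + 1),
        (add_left_injective (1 : ℤ)).tendsto_cofinite.eventually (hxs j)] with i h1 h2
      simp only [shiftMap, Equiv.coe_fn_mk]
      rw [show j + 1 + i = i + (j + 1) by ring, h1, show j + (i + 1) = i + 1 + j by ring, h2]
      ring_nf)
  refine ⟨K, hK, y, hy, ?_, ?_⟩
  · have hle : (atBot : Filter ℤ) ≤ cofinite := by rw [Int.cofinite_eq]; exact le_sup_left
    filter_upwards [tendsto_shiftDist_zero_iff.mp hbot 0, (hxs 0).filter_mono hle] with i h1 h2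
    rw [add_zero] at h2
    simpa [shiftMap_zpow_apply, h2] using h1
  · have hle : (atTop : Filter ℤ) ≤ cofinite := by rw [Int.cofinite_eq]; exact le_sup_right
    filter_upwards [tendsto_shiftDist_zero_iff.mp htop 0, (hxs 0).filter_mono hle] with i h1 h2
    rw [add_zero] at h2
    simpa [shiftMap_zpow_apply, h2] using h1

lemma gap_of_symbolicShadowing {A : Type*} [DecidableEq A] {X : Set (ℤ → A)}
    (hinv : ⇑shiftMap '' X = X) {N : ℕ} (h : SymbolicShadowing X N) :
    ShiftTwoSidedLimitShadowingWithGapOn X := by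
  refine ⟨N, fun x hx hpo => ?_⟩
  have hstep : ∀ t, ∀ᶠ i : ℤ in cofinite, x i (t + 1) = x (i + 1) t :=
    tendsto_shiftDist_zero_iff.mp hpo
  have hiter : ∀ (k : ℕ) (t : ℤ), ∀ᶠ i : ℤ in cofinite, x i (t + k) = x (i + k) t := by
    intro k
    induction k with
    | zero => simp
    | succ k ih =>
      intro t
      filter_upwards [ih (t + 1),
        (add_left_injective (k : ℤ)).tendsto_cofinite.eventually (hstep t)] with i h1 h2
      push_cast
      rw [show t + (k + 1 : ℤ) = t + 1 + k by ring, h1, h2]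
      ring_nf
  have hcoord : ∀ t : ℤ, ∀ᶠ i : ℤ in cofinite, x (i + t) 0 = x i t := by
    intro t
    obtain ⟨n, rfl | rfl⟩ := t.eq_nat_or_neg
    · filter_upwards [hiter n 0] with i hi
      rw [← hi, zero_add]
    · filter_upwards [(add_left_injective (-n : ℤ)).tendsto_cofinite.eventually
        (hiter n (-n))] with i hi
      simpa using hi
  obtain ⟨K, hK, y, hy, hbot, htop⟩ := h (fun i => x i 0) (by
    intro m
    have hfin := (Set.finite_Icc (-(m : ℤ)) m).eventually_all (l := cofinite) |>.mpr
      (fun j _ => hcoord j)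
    filter_upwards [hfin] with i hi
    refine ⟨_, translate_mem hinv (hx i) (-i), fun j hj => ?_⟩
    have := hi (j - i) (abs_le.mp hj)
    simpa [sub_eq_add_neg] using this)
  refine ⟨K, hK, y, hy, ?_, ?_⟩
  · refine tendsto_shiftDist_zero_iff.mpr fun j => ?_
    have hle : (atBot : Filter ℤ) ≤ cofinite := by rw [Int.cofinite_eq]; exact le_sup_left
    filter_upwards [(hcoord j).filter_mono hle,
      (tendsto_atBot_add_const_right _ j tendsto_id).eventually hbot] with i h1 h2
    rw [shiftMap_zpow_apply, ← h1, add_comm]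
    exact h2
  · refine tendsto_shiftDist_zero_iff.mpr fun j => ?_
    have hle : (atTop : Filter ℤ) ≤ cofinite := by rw [Int.cofinite_eq]; exact le_sup_right
    filter_upwards [(hcoord j).filter_mono hle,
      (tendsto_atTop_add_const_right _ j tendsto_id).eventually htop] with i h1 h2
    rw [shiftMap_zpow_apply, ← h1, show j + (K + i) = K + (i + j) by ring]
    exact h2

/-! ### Finite type approximations -/

/-- The window of length `m` of `g` starting at `i` occurs in `X` (at the same place). -/
def Admissible {A : Type*} (X : Set (ℤ → A)) (m : ℕ) (g : ℤ → A) (i : ℤ) : Prop :=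
  ∃ x ∈ X, ∀ j, i ≤ j → j < i + m → g j = x j

/-- The shift of finite type determined by the words of length `m` of `X`. -/
def approx {A : Type*} (X : Set (ℤ → A)) (m : ℕ) : Set (ℤ → A) :=
  {g | ∀ i, Admissible X m g i}

/-- The sequence equal to `f` to the left of `a` and to `g` from `a` on. -/
def glue {A : Type*} (f g : ℤ → A) (a : ℤ) : ℤ → A := fun j => if j < a then f j else g j

lemma subset_approx {A : Type*} (X : Set (ℤ → A)) (m : ℕ) : X ⊆ approx X m :=
  fun x hx _ => ⟨x, hx, fun _ _ _ => rfl⟩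

lemma Admissible.mono {A : Type*} {X : Set (ℤ → A)} {m n : ℕ} (hmn : m ≤ n) {g : ℤ → A}
    {i : ℤ} (h : Admissible X n g i) : Admissible X m g i := by
  obtain ⟨x, hx, hg⟩ := h
  exact ⟨x, hx, fun j h1 h2 => hg j h1 (by omega)⟩

lemma Admissible.congr {A : Type*} {X : Set (ℤ → A)} {m : ℕ} {f g : ℤ → A} {i : ℤ}
    (h : Admissible X m f i) (hfg : ∀ j, i ≤ j → j < i + m → g j = f j) :
    Admissible X m g i := by
  obtain ⟨x, hx, hf⟩ := h
  exact ⟨x, hx, fun j h1 h2 => (hfg j h1 h2).trans (hf j h1 h2)⟩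

lemma glue_mem_approx {A : Type*} {X : Set (ℤ → A)} {m : ℕ} {f g : ℤ → A} {a : ℤ}
    (hf : ∀ i < a, Admissible X m f i) (hg : ∀ i ≥ a, Admissible X m g i)
    (hfg : ∀ j, a ≤ j → j < a + m → f j = g j) : glue f g a ∈ approx X m := by
  intro i
  rcases lt_or_ge i a with hi | hi
  · refine (hf i hi).congr fun j h1 h2 => ?_
    unfold glue
    split_ifs with h
    · rfl
    · exact (hfg j (by omega) (by omega)).symm
  · refine (hg i hi).congr fun j h1 h2 => ?_
    unfold glue
    rw [if_neg (by omega)]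

lemma Admissible.translate {A : Type*} {X : Set (ℤ → A)} (hinv : ⇑shiftMap '' X = X)
    {m : ℕ} {g : ℤ → A} {i k : ℤ} (hg : Admissible X m g (i + k)) :
    Admissible X m (fun j => g (j + k)) i := by
  obtain ⟨x, hx, h⟩ := hg
  exact ⟨_, translate_mem hinv hx k, fun j h1 h2 => h _ (by omega) (by omega)⟩

lemma translate_mem_approx {A : Type*} {X : Set (ℤ → A)} (hinv : ⇑shiftMap '' X = X)
    {m : ℕ} {g : ℤ → A} (hg : g ∈ approx X m) (k : ℤ) :
    (fun j => g (j + k)) ∈ approx X m :=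
  fun i => (hg (i + k)).translate hinv

lemma isShiftOfFiniteType_iff {A : Type*} {X : Set (ℤ → A)} (hinv : ⇑shiftMap '' X = X) :
    IsShiftOfFiniteType X ↔ ∃ m, approx X m ⊆ X := by
  constructor
  · rintro ⟨N, 𝓛, h⟩
    refine ⟨N + 1, fun g hg => (h g).mpr fun j => ?_⟩
    obtain ⟨x, hx, hgx⟩ := hg j
    convert (h x).mp hx j using 2 with k
    exact hgx _ (by omega) (by push_cast; omega)
  · rintro ⟨m, h⟩
    refine ⟨m, {w | ∃ x ∈ X, ∀ k : Fin (m + 1), w k = x (k : ℕ)}, fun g => ⟨?_, ?_⟩⟩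
    · intro hg j
      exact ⟨_, translate_mem hinv hg j, fun k => by simp [add_comm]⟩
    · intro hg
      refine h fun i => ?_
      obtain ⟨x, hx, hgx⟩ := hg i
      refine ⟨_, translate_mem hinv hx (-i), fun j h1 h2 => ?_⟩
      have := hgx ⟨(j - i).toNat, by omega⟩
      simp only [Int.toNat_of_nonneg (show 0 ≤ j - i by omega)] at this
      simpa [sub_eq_add_neg] using this

/-- Some point of `approx X m` follows `x` up to time `m`, and follows `y` from time `l` on. -/
def Link {A : Type*} (X : Set (ℤ → A)) (m : ℕ) (x y : ℤ → A) (l : ℕ) : Prop :=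
  ∃ g ∈ approx X m, (∀ j < (m : ℤ), g j = x j) ∧ ∀ j ≥ 0, g (j + l) = y j

lemma Link.trans {A : Type*} {X : Set (ℤ → A)} (hinv : ⇑shiftMap '' X = X) {m : ℕ}
    {x y z : ℤ → A} {k l : ℕ} (h₁ : Link X m x y k) (h₂ : Link X m y z l) :
    Link X m x z (k + l) := by
  obtain ⟨g, hg, hgx, hgy⟩ := h₁
  obtain ⟨h, hh, hhy, hhz⟩ := h₂
  have hgh : ∀ j : ℤ, k ≤ j → j < k + m → g j = h (j + -k) := fun j h1 h2 => by
    rw [hhy _ (by omega), ← hgy _ (by omega)]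
    simp
  refine ⟨glue g (fun j => h (j + -k)) k, glue_mem_approx (fun i _ => hg i)
    (fun i _ => translate_mem_approx hinv hh _ i) hgh, fun j hj => ?_, fun j hj => ?_⟩
  · unfold glue
    split_ifs with hjk
    · exact hgx j hj
    · exact (hgh j (by omega) (by omega)).symm.trans (hgx j hj)
  · unfold glue
    rw [if_neg (by push_cast; omega), ← hhz j hj]
    push_cast
    ring_nf

lemma Link.of_agree {A : Type*} {X : Set (ℤ → A)} {m : ℕ} {x y : ℤ → A} (hx : x ∈ X)
    (hy : y ∈ X) (hxy : ∀ j, 0 ≤ j → j < (m : ℤ) → x j = y j) : Link X m x y 0 := by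
  refine ⟨glue x y 0, glue_mem_approx (fun i _ => subset_approx X m hx i)
    (fun i _ => subset_approx X m hy i) (by simpa using hxy), fun j hj => ?_, fun j hj => ?_⟩
  · unfold glue
    split_ifs with h
    · rfl
    · exact (hxy j (by omega) hj).symm
  · unfold glue
    rw [if_neg (by push_cast; omega)]
    simp

lemma Link.translate {A : Type*} {X : Set (ℤ → A)} {m : ℕ} {x y : ℤ → A} (hx : x ∈ X)
    {n : ℕ} (hxy : ∀ j, y j = x (j + n)) : Link X m x y n :=
  ⟨x, subset_approx X m hx, fun _ _ => rfl, fun j _ => (hxy j).symm⟩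

/-! ### Transitive shifts of finite type have the shadowing property -/

lemma isOpen_setOf_agree {A : Type*} [TopologicalSpace A] [DiscreteTopology A] (x : ℤ → A)
    (a b : ℤ) : IsOpen {f : ℤ → A | ∀ j, a ≤ j → j < b → f j = x j} := by
  have : {f : ℤ → A | ∀ j, a ≤ j → j < b → f j = x j} =
      (Set.Ico a b).pi fun j => {x j} := by
    ext f
    simp [Set.mem_pi]
  rw [this]
  exact isOpen_set_pi (Set.finite_Ico a b) fun _ _ => isOpen_discrete _

lemma exists_link_of_transitive {A : Type*} [TopologicalSpace A] [DiscreteTopology A]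
    {X : Set (ℤ → A)} (hinv : ⇑shiftMap '' X = X) (htr : ShiftTransitiveOn X) (m : ℕ)
    {x y : ℤ → A} (hx : x ∈ X) (hy : y ∈ X) : ∃ n, 0 < n ∧ Link X m x y n := by
  obtain ⟨n, hn, _, ⟨z, ⟨hzx, hz⟩, rfl⟩, hzy, hz'⟩ := htr _ _ (isOpen_setOf_agree x 0 m)
    (isOpen_setOf_agree y 0 m) ⟨x, fun _ _ _ => rfl, hx⟩ ⟨y, fun _ _ _ => rfl, hy⟩
  refine ⟨0 + n + 0, by omega, ((Link.of_agree hx hz fun j h1 h2 => (hzx j h1 h2).symm).trans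
    hinv (Link.translate hz fun j => ?_)).trans hinv (Link.of_agree hz' hy hzy)⟩
  exact shiftMap_pow_apply n z j

lemma exists_link_bounded {A : Type*} [Finite A] [TopologicalSpace A] [DiscreteTopology A]
    {X : Set (ℤ → A)} (hinv : ⇑shiftMap '' X = X) (htr : ShiftTransitiveOn X) (m : ℕ) :
    ∃ B : ℕ, ∀ x ∈ X, ∀ y ∈ X, ∃ n, 0 < n ∧ n ≤ B ∧ Link X m x y n := by
  have key : ∀ p : (Fin m → A) × (Fin m → A), ∃ n, ∀ x ∈ X, ∀ y ∈ X,
      (∀ k : Fin m, x (k : ℕ) = p.1 k) → (∀ k : Fin m, y (k : ℕ) = p.2 k) →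
      0 < n ∧ Link X m x y n := by
    intro p
    by_cases hp : ∃ x ∈ X, ∃ y ∈ X, (∀ k : Fin m, x (k : ℕ) = p.1 k) ∧
        ∀ k : Fin m, y (k : ℕ) = p.2 k
    · obtain ⟨x, hx, y, hy, hxp, hyp⟩ := hp
      obtain ⟨n, hn, hl⟩ := exists_link_of_transitive hinv htr m hx hy
      have agree : ∀ (u v : ℤ → A) (w : Fin m → A), (∀ k : Fin m, u (k : ℕ) = w k) →
          (∀ k : Fin m, v (k : ℕ) = w k) → ∀ j, 0 ≤ j → j < (m : ℤ) → u j = v j := by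
        intro u v w hu hv j h1 h2
        lift j to ℕ using h1
        exact (hu ⟨j, by omega⟩).trans (hv ⟨j, by omega⟩).symm
      refine ⟨0 + n + 0, fun x' hx' y' hy' hxp' hyp' => ⟨by omega, ?_⟩⟩
      exact ((Link.of_agree hx' hx (agree _ _ _ hxp' hxp)).trans hinv hl).trans hinv
        (Link.of_agree hy hy' (agree _ _ _ hyp hyp'))
    · exact ⟨0, fun x hx y hy h1 h2 => absurd ⟨x, hx, y, hy, h1, h2⟩ hp⟩
  choose F hF using key
  obtain ⟨B, hB⟩ := (Set.finite_range F).bddAbove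
  refine ⟨B, fun x hx y hy => ?_⟩
  obtain ⟨h1, h2⟩ := hF (fun k => x (k : ℕ), fun k => y (k : ℕ)) x hx y hy
    (fun _ => rfl) fun _ => rfl
  exact ⟨_, h1, hB ⟨_, rfl⟩, h2⟩

lemma exists_link_in_range {A : Type*} {X : Set (ℤ → A)} (hinv : ⇑shiftMap '' X = X)
    {m B : ℕ} (hB : ∀ x ∈ X, ∀ y ∈ X, ∃ n, 0 < n ∧ n ≤ B ∧ Link X m x y n)
    {x y : ℤ → A} (hx : x ∈ X) (hy : y ∈ X) (n : ℕ) :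
    ∃ l, n < l ∧ l ≤ n + B ∧ Link X m x y l := by
  induction n with
  | zero => simpa using hB x hx y hy
  | succ n ih =>
    obtain ⟨l, h1, h2, hl⟩ := ih
    rcases Nat.lt_or_ge (n + 1) l with h | h
    · exact ⟨l, h, by omega, hl⟩
    · obtain ⟨c, hc, hcB, hlc⟩ := hB y hy y hy
      exact ⟨l + c, by omega, by omega, hl.trans hinv hlc⟩

lemma symbolicShadowing_of_transitive {A : Type*} [Finite A] [TopologicalSpace A]
    [DiscreteTopology A] {X : Set (ℤ → A)} (hinv : ⇑shiftMap '' X = X)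
    (hsft : IsShiftOfFiniteType X) (htr : ShiftTransitiveOn X) :
    ∃ N, SymbolicShadowing X N := by
  obtain ⟨m, hm⟩ := (isShiftOfFiniteType_iff hinv).mp hsft
  obtain ⟨B, hB⟩ := exists_link_bounded hinv htr m
  refine ⟨B, fun s hs => ?_⟩
  have hs := hs m
  rw [Int.cofinite_eq, eventually_sup] at hs
  obtain ⟨a, ha⟩ := eventually_atBot.mp hs.1
  obtain ⟨b, hb⟩ := eventually_atTop.mp hs.2
  obtain ⟨I, hIa, hIb⟩ : ∃ I : ℕ, -(I : ℤ) ≤ a ∧ b ≤ I :=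
    ⟨a.natAbs + b.natAbs, by omega, by omega⟩
  have adm : ∀ i, (∃ x ∈ X, ∀ j, |j - i| ≤ (m : ℤ) → s j = x j) → Admissible X m s i := by
    rintro i ⟨x, hx, h⟩
    exact ⟨x, hx, fun j h1 h2 => h j (abs_le.mpr (by omega))⟩
  obtain ⟨r, hr, hsr⟩ := ha (-I) hIa
  obtain ⟨t, ht, hst⟩ := hb I hIb
  have hp : glue s r (-I) ∈ X := hm <| glue_mem_approx
    (fun i hi => adm i (ha i (by omega))) (fun i _ => subset_approx X m hr i)
    fun j h1 h2 => hsr j (abs_le.mpr (by omega))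
  have hq : glue t s I ∈ X := hm <| glue_mem_approx (fun i _ => subset_approx X m ht i)
    (fun i hi => adm i (hb i (by omega))) fun j h1 h2 => (hst j (abs_le.mpr (by omega))).symm
  obtain ⟨l, hl1, hl2, g, hg, hgp, hgq⟩ := exists_link_in_range hinv hB
    (translate_mem hinv hp (-I)) (translate_mem hinv hq I) (2 * I)
  refine ⟨l - 2 * I, abs_le.mpr (by omega), _, translate_mem hinv (hm hg) I, ?_, ?_⟩
  · filter_upwards [eventually_lt_atBot (-(I : ℤ))] with i hi
    rw [hgp _ (by omega)]
    simp [glue, hi]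
  · filter_upwards [eventually_ge_atTop (I : ℤ)] with i hi
    have := hgq (i - I) (by omega)
    rw [show (l : ℤ) - 2 * I + i + I = i - I + l by ring, this]
    simp [glue, not_lt.mpr hi]

/-! ### Shadowing implies transitivity and finite type -/

lemma exists_cluster_point {A : Type*} [Finite A] [TopologicalSpace A] [DiscreteTopology A]
    {X : Set (ℤ → A)} (hcl : IsClosed X) {u : ℕ → ℤ → A} (hu : ∀ n, u n ∈ X) :
    ∃ w ∈ X, ∀ (a b : ℤ) (n₀ : ℕ), ∃ n ≥ n₀, ∀ j, a ≤ j → j < b → u n j = w j := by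
  obtain ⟨w, hw, hcp⟩ := hcl.isCompact.exists_mapClusterPt (f := atTop) (u := u)
    (tendsto_principal.mpr (Eventually.of_forall hu))
  refine ⟨w, hw, fun a b n₀ => ?_⟩
  exact frequently_atTop.mp (hcp.frequently
    ((isOpen_setOf_agree w a b).mem_nhds fun _ _ _ => rfl)) n₀

lemma mem_of_forall_agree {A : Type*} [Finite A] [TopologicalSpace A] [DiscreteTopology A]
    {X : Set (ℤ → A)} (hcl : IsClosed X) {b : ℤ → A}
    (h : ∀ R : ℕ, ∃ x ∈ X, ∀ j, |j| ≤ (R : ℤ) → x j = b j) : b ∈ X := by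
  choose u hu hub using h
  obtain ⟨w, hw, hwu⟩ := exists_cluster_point hcl hu
  convert hw
  ext j
  obtain ⟨n, hn, hnj⟩ := hwu j (j + 1) j.natAbs
  rw [← hnj j le_rfl (by omega), hub n j (by rw [← Int.natCast_natAbs]; exact_mod_cast hn)]

lemma exists_agree_subset {A : Type*} [TopologicalSpace A] {U : Set (ℤ → A)} (hU : IsOpen U)
    {x : ℤ → A} (hx : x ∈ U) : ∃ R : ℕ, ∀ f : ℤ → A, (∀ j, |j| ≤ (R : ℤ) → f j = x j) → f ∈ U := by
  obtain ⟨I, u, hu, hIU⟩ := isOpen_pi_iff.mp hU x hx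
  refine ⟨I.sup Int.natAbs, fun f hf => hIU fun j hj => ?_⟩
  rw [hf j]
  · exact (hu j hj).2
  · have : j.natAbs ≤ I.sup Int.natAbs := Finset.le_sup (f := Int.natAbs) hj
    rw [← Int.natCast_natAbs]
    exact_mod_cast this

lemma SymbolicShadowing.exists_connecting {A : Type*} {X : Set (ℤ → A)} {N : ℕ}
    (h : SymbolicShadowing X N) {u v : ℤ → A} (hu : u ∈ X) (hv : v ∈ X) :
    ∃ z ∈ X, ∃ (K : ℤ) (I : ℕ), (∀ j < -(I : ℤ), z j = u j) ∧
      ∀ j ≥ (I : ℤ), z (K + j) = v j := by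
  obtain ⟨K, -, z, hz, hbot, htop⟩ := h (glue u v 0) (by
    intro m
    refine (Set.finite_Icc (-(m : ℤ)) m).subset fun i hi => ?_
    by_contra hi'
    apply hi
    rw [Set.mem_Icc, ← abs_le] at hi'
    rcases lt_or_ge i 0 with h0 | h0
    · refine ⟨u, hu, fun j hj => if_pos ?_⟩
      rw [abs_le] at hi' hj
      omega
    · refine ⟨v, hv, fun j hj => if_neg ?_⟩
      rw [abs_le] at hi' hj
      omega)
  obtain ⟨a, ha⟩ := eventually_atBot.mp hbot
  obtain ⟨b, hb⟩ := eventually_atTop.mp htop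
  refine ⟨z, hz, K, a.natAbs + b.natAbs, fun j hj => ?_, fun j hj => ?_⟩
  · rw [ha j (by omega)]
    exact if_pos (by omega)
  · rw [hb j (by omega)]
    exact if_neg (by omega)

lemma SymbolicShadowing.exists_link {A : Type*} [Finite A] [TopologicalSpace A]
    [DiscreteTopology A] {X : Set (ℤ → A)} (hcl : IsClosed X) (hinv : ⇑shiftMap '' X = X)
    {N : ℕ} (h : SymbolicShadowing X N) (m : ℕ) {x y : ℤ → A} (hx : x ∈ X) (hy : y ∈ X) :
    ∃ l, Link X m x y l := by
  obtain ⟨w, hw, hxw⟩ := exists_cluster_point hcl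
    (u := fun n j => x (j + n)) fun n => translate_mem hinv hx n
  obtain ⟨v, hv, hyv⟩ := exists_cluster_point hcl
    (u := fun n j => y (j + -n)) fun n => translate_mem hinv hy (-n)
  obtain ⟨z, hz, K, I, hzw, hzv⟩ := h.exists_connecting hw hv
  -- `x` is followed until it is close to a translate of `z`
  obtain ⟨n, hn, hxn⟩ := hxw (-(I + m : ℕ)) (-I) (I + m)
  have h₁ : Link X m x (fun j => x (j + (n - (I + m) : ℕ))) (n - (I + m)) :=
    Link.translate hx fun _ => rfl
  have h₂ : Link X m (fun j => x (j + (n - (I + m) : ℕ))) (fun j => z (j + -(I + m : ℕ))) 0 := by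
    refine Link.of_agree (translate_mem hinv hx _) (translate_mem hinv hz _) fun j h1 h2 => ?_
    rw [hzw _ (by push_cast; omega), ← hxn _ (by omega) (by push_cast; omega)]
    congr 1
    push_cast [Nat.cast_sub hn]
    ring
  -- `z` is followed until it agrees with a translate of `v`
  set q : ℕ := I + K.natAbs with hq
  have hl : ∃ l : ℕ, (l : ℤ) = I + m + q + K := ⟨(I + m + q + K : ℤ).toNat, by omega⟩
  obtain ⟨l, hl⟩ := hl
  have h₃ : Link X m (fun j => z (j + -(I + m : ℕ))) (fun j => z (j + (q + K))) l := by
    refine Link.translate (translate_mem hinv hz _) fun j => ?_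
    rw [hl]
    congr 1
    push_cast
    ring
  -- `v` returns to the past of `y`
  obtain ⟨k, hk, hyk⟩ := hyv q (q + m) q
  have h₄ : Link X m (fun j => z (j + (q + K))) (fun j => y (j + -(k - q : ℕ))) 0 := by
    refine Link.of_agree (translate_mem hinv hz _) (translate_mem hinv hy _) fun j h1 h2 => ?_
    rw [show j + ((q : ℤ) + K) = K + (j + q) by ring, hzv _ (by omega),
      ← hyk _ (by omega) (by omega)]
    congr 1
    push_cast [Nat.cast_sub hk]
    ring
  have h₅ : Link X m (fun j => y (j + -(k - q : ℕ))) y (k - q) :=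
    Link.translate (translate_mem hinv hy _) fun j => by simp
  exact ⟨_, (((h₁.trans hinv h₂).trans hinv h₃).trans hinv h₄).trans hinv h₅⟩

/-- Extend a sequence that ends as a point of `X` by a prescribed block, within the
approximation of level `n`. -/
lemma exists_extension {A : Type*} {X : Set (ℤ → A)} (hinv : ⇑shiftMap '' X = X) {n : ℕ}
    (hlink : ∀ x ∈ X, ∀ y ∈ X, ∃ l, Link X n x y l) {b x y : ℤ → A} {d : ℕ}
    (hb : b ∈ approx X n) (hx : x ∈ X) (hy : y ∈ X) (hbx : ∀ j < (n : ℤ), b j = x j)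
    (hby : ∀ j ≥ 0, b (j + d) = y j) {f z : ℤ → A} {e : ℤ} (hz : z ∈ X)
    (hfz : ∀ j ≥ 0, f (j + e) = z j) :
    ∃ (f' z' : ℤ → A) (e' : ℤ), z' ∈ X ∧ (∀ j ≥ 0, f' (j + e') = z' j) ∧ e + n + 1 ≤ e' ∧
      (∀ j < e + n, f' j = f j) ∧ (∀ i ≥ e, Admissible X n f' i) ∧
      ∃ p ≥ e, p + d ≤ e' ∧ ∀ j : ℤ, 0 ≤ j → j < d → f' (j + p) = b j := by
  obtain ⟨l, g, hg, hgz, hgx⟩ := hlink z hz x hx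
  have hgb : ∀ j : ℤ, l ≤ j → j < l + n → g j = b (j + -l) := fun j h1 h2 => by
    rw [hbx _ (by omega), ← hgx _ (by omega)]
    simp
  set h := glue g (fun j => b (j + -l)) l with hdef
  have hh : h ∈ approx X n := glue_mem_approx (fun i _ => hg i)
    (fun i _ => translate_mem_approx hinv hb _ i) hgb
  have hhz : ∀ j < (n : ℤ), h j = z j := by
    intro j hj
    simp only [hdef, glue]
    split_ifs with hjl
    · exact hgz j hj
    · rw [← hgb j (by omega) (by omega), hgz j hj]
  have hhb : ∀ j ≥ 0, h (j + l) = b j := by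
    intro j hj
    simp only [hdef, glue]
    rw [if_neg (by omega)]
    simp
  set f' := glue f (fun j => h (j + -e)) e with hdef'
  have hf' : ∀ j ≥ e, f' j = h (j + -e) := fun j hj => if_neg (by omega)
  refine ⟨f', _, e + l + d + (n + 1), translate_mem hinv hy (n + 1), ?_, by omega, ?_, ?_,
    e + l, by omega, by omega, ?_⟩
  · intro j hj
    rw [hf' _ (by omega), ← hby _ (by omega), ← hhb _ (by omega)]
    congr 1
    ring
  · intro j hj
    rcases lt_or_ge j e with hje | hje
    · exact if_pos hje
    · rw [hf' j hje, hhz _ (by omega), ← hfz _ (by omega)]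
      simp
  · intro i hi
    exact (translate_mem_approx hinv hh (-e) i).congr fun j h1 h2 => hf' j (by omega)
  · intro j h1 h2
    rw [hf' _ (by omega), ← hhb j h1]
    congr 1
    ring

/-- Blocks which are better and better admissible can be arranged in order in a single
asymptotically admissible sequence. -/
lemma exists_asympAdmissible_containing {A : Type*} {X : Set (ℤ → A)} (hne : X.Nonempty)
    (hinv : ⇑shiftMap '' X = X)
    (hlink : ∀ n, ∀ x ∈ X, ∀ y ∈ X, ∃ l, Link X n x y l) {b x y : ℕ → ℤ → A} {d : ℕ → ℕ}
    (hb : ∀ n, b n ∈ approx X n) (hx : ∀ n, x n ∈ X) (hy : ∀ n, y n ∈ X)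
    (hbx : ∀ n : ℕ, ∀ j < (n : ℤ), b n j = x n j) (hby : ∀ n, ∀ j ≥ 0, b n (j + d n) = y n j) :
    ∃ s, AsympAdmissible X s ∧
      ∀ n : ℕ, ∃ p ≥ (n : ℤ), ∀ j, 0 ≤ j → j < (d n : ℤ) → s (j + p) = b n j := by
  obtain ⟨x₀, hx₀⟩ := hne
  let S := {q : (ℤ → A) × (ℤ → A) × ℤ // q.2.1 ∈ X ∧ ∀ j ≥ 0, q.1 (j + q.2.2) = q.2.1 j}
  have step : ∀ (n : ℕ) (q : S), ∃ q' : S, q.1.2.2 + n + 1 ≤ q'.1.2.2 ∧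
      (∀ j < q.1.2.2 + n, q'.1.1 j = q.1.1 j) ∧
      (∀ i ≥ q.1.2.2, Admissible X n q'.1.1 i) ∧
      ∃ p ≥ q.1.2.2, p + d n ≤ q'.1.2.2 ∧ ∀ j : ℤ, 0 ≤ j → j < d n → q'.1.1 (j + p) = b n j := by
    rintro n ⟨⟨f, z, e⟩, hz, hfz⟩
    obtain ⟨f', z', e', hz', hfz', h⟩ := exists_extension hinv (hlink n) (hb n) (hx n) (hy n)
      (hbx n) (hby n) hz hfz
    exact ⟨⟨⟨f', z', e'⟩, hz', hfz'⟩, h⟩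
  choose F hF using step
  let Q : ℕ → S := fun n => Nat.rec ⟨(x₀, x₀, 0), hx₀, by simp⟩ (fun n q => F n q) n
  obtain ⟨f, hf⟩ : ∃ f : ℕ → ℤ → A, f = fun n => (Q n).1.1 := ⟨_, rfl⟩
  obtain ⟨e, he⟩ : ∃ e : ℕ → ℤ, e = fun n => (Q n).1.2.2 := ⟨_, rfl⟩
  have hstep : ∀ n, e n + n + 1 ≤ e (n + 1) ∧
      (∀ j < e n + n, f (n + 1) j = f n j) ∧
      (∀ i ≥ e n, Admissible X n (f (n + 1)) i) ∧
      ∃ p ≥ e n, p + d n ≤ e (n + 1) ∧ ∀ j : ℤ, 0 ≤ j → j < d n → f (n + 1) (j + p) = b n j := by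
    subst hf he
    exact fun n => hF n (Q n)
  have hf0 : f 0 = x₀ := by subst hf; rfl
  have he0 : e 0 = 0 := by subst he; rfl
  have hemono : Monotone e := monotone_nat_of_le_succ fun n => by
    have := (hstep n).1
    omega
  have hen : ∀ n : ℕ, (n : ℤ) ≤ e n := by
    intro n
    induction n with
    | zero => simp [he0]
    | succ n ih =>
      have := (hstep n).1
      push_cast
      omega
  have hstable : ∀ n k, n ≤ k → ∀ j < e n + n, f k j = f n j := by
    intro n k hnk
    induction k, hnk using Nat.le_induction with
    | base => exact fun _ _ => rfl
    | succ k hk ih =>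
      intro j hj
      rw [(hstep k).2.1 j (by have := hemono hk; omega), ih j hj]
  obtain ⟨s, hs⟩ : ∃ s : ℤ → A, ∀ n, ∀ j < e n + n, s j = f n j := by
    refine ⟨fun j => f (j.toNat + 1) j, fun n j hj => ?_⟩
    have := hen (j.toNat + 1)
    rcases le_total n (j.toNat + 1) with h | h
    · exact hstable _ _ h j hj
    · exact (hstable _ _ h j (by push_cast at this ⊢; omega)).symm
  have hadm : ∀ n, ∀ i ≥ e n, Admissible X n s i := by
    intro n i hi
    obtain ⟨k, hnk, hki⟩ : ∃ k ≥ n, e k ≤ i ∧ i < e (k + 1) := by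
      have hex : ∃ k, i < e k :=
        ⟨i.toNat + 1, by have := hen (i.toNat + 1); push_cast at this; omega⟩
      classical
      have hspec := Nat.find_spec hex
      have hpos : n < Nat.find hex := by
        by_contra hcon
        have := hemono (not_lt.mp hcon)
        omega
      refine ⟨Nat.find hex - 1, by omega, ?_, ?_⟩
      · exact not_lt.mp (Nat.find_min hex (by omega))
      · rwa [Nat.sub_add_cancel (by omega)]
    refine (((hstep k).2.2.1 i hki.1).mono hnk).congr fun j h1 h2 => hs _ _ ?_
    push_cast
    omega
  refine ⟨s, fun m => ?_, fun n => ?_⟩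
  · have hfin := Set.finite_Icc (-(m : ℤ)) (e (2 * m + 1) + m)
    refine hfin.subset fun i hi => ?_
    by_contra hi'
    apply hi
    rw [Set.mem_Icc, not_and_or] at hi'
    by_cases hneg : i < -(m : ℤ)
    · refine ⟨x₀, hx₀, fun j hj => ?_⟩
      rw [hs 0 j (by rw [abs_le] at hj; simp only [he0]; push_cast; omega), hf0]
    · obtain ⟨x, hx, h⟩ := hadm (2 * m + 1) (i - m) (by omega)
      exact ⟨x, hx, fun j hj => by
        rw [abs_le] at hj
        exact h j (by omega) (by push_cast; omega)⟩
  · obtain ⟨-, -, -, p, hp, hpd, hpb⟩ := hstep n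
    refine ⟨p, (hen n).trans hp, fun j h1 h2 => ?_⟩
    rw [hs (n + 1) _ (by push_cast; omega), hpb j h1 h2]

lemma SymbolicShadowing.exists_point_containing {A : Type*} [Finite A] [TopologicalSpace A]
    [DiscreteTopology A] {X : Set (ℤ → A)} (hne : X.Nonempty) (hcl : IsClosed X)
    (hinv : ⇑shiftMap '' X = X) {N : ℕ} (h : SymbolicShadowing X N)
    {b x y : ℕ → ℤ → A} {d : ℕ → ℕ}
    (hb : ∀ n, b n ∈ approx X n) (hx : ∀ n, x n ∈ X) (hy : ∀ n, y n ∈ X)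
    (hbx : ∀ n : ℕ, ∀ j < (n : ℤ), b n j = x n j) (hby : ∀ n, ∀ j ≥ 0, b n (j + d n) = y n j) :
    ∃ z ∈ X, ∃ n₀ : ℕ, ∃ K : ℤ, ∀ n ≥ n₀, ∃ p ≥ (n : ℤ), ∀ j, 0 ≤ j → j < (d n : ℤ) →
      z (j + p + K) = b n j := by
  obtain ⟨s, hs, hsb⟩ := exists_asympAdmissible_containing hne hinv
    (fun n x hx y hy => h.exists_link hcl hinv n hx hy) hb hx hy hbx hby
  obtain ⟨K, -, z, hz, -, htop⟩ := h s hs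
  obtain ⟨a, ha⟩ := eventually_atTop.mp htop
  refine ⟨z, hz, a.toNat, K, fun n hn => ?_⟩
  obtain ⟨p, hp, hpb⟩ := hsb n
  refine ⟨p, hp, fun j h1 h2 => ?_⟩
  rw [← hpb j h1 h2, ← ha _ (by omega), add_comm]

lemma SymbolicShadowing.transitive {A : Type*} [Finite A] [TopologicalSpace A]
    [DiscreteTopology A] {X : Set (ℤ → A)} (hne : X.Nonempty) (hcl : IsClosed X)
    (hinv : ⇑shiftMap '' X = X) {N : ℕ} (h : SymbolicShadowing X N) :
    ShiftTransitiveOn X := by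
  rintro U V hU hV ⟨u, hu, huX⟩ ⟨v, hv, hvX⟩
  obtain ⟨R, hR⟩ := exists_agree_subset hU hu
  obtain ⟨T, hT⟩ := exists_agree_subset hV hv
  let b : ℕ → ℤ → A := fun n j => if Even n then u (j + -R) else v (j + -T)
  have hb : ∀ n, b n ∈ X := by
    intro n
    by_cases hn : Even n
    · simpa only [b, if_pos hn] using translate_mem hinv huX (-R)
    · simpa only [b, if_neg hn] using translate_mem hinv hvX (-T)
  obtain ⟨z, hz, n₀, K, hzb⟩ := h.exists_point_containing hne hcl hinv
    (d := fun _ => 2 * (R + T) + 1) (fun n => subset_approx X n (hb n)) hb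
    (fun n => translate_mem hinv (hb n) (2 * (R + T) + 1 : ℕ)) (fun _ _ _ => rfl)
    fun _ _ _ => rfl
  obtain ⟨p, -, hpb⟩ := hzb (2 * n₀) (by omega)
  obtain ⟨q, hq, hqb⟩ := hzb (2 * (n₀ + (p + R).natAbs + T) + 1) (by omega)
  have hpq : p + R < q + T := by
    push_cast at hq
    have := le_abs_self (p + R : ℤ)
    have := abs_nonneg (p + R : ℤ)
    omega
  obtain ⟨k, hk⟩ : ∃ k : ℕ, (k : ℤ) = q + T - (p + R) :=
    ⟨(q + T - (p + R)).toNat, by omega⟩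
  refine ⟨k, by omega, _, ⟨_, ⟨hR _ ?_, translate_mem hinv hz (p + R + K)⟩, rfl⟩, hT _ ?_, ?_⟩
  · intro j hj
    rw [abs_le] at hj
    have := hpb (j + R) (by omega) (by push_cast; omega)
    simp only [b, if_pos (even_two_mul n₀)] at this
    rw [show j + (p + R + K) = j + R + p + K by ring, this]
    simp
  · intro j hj
    rw [abs_le] at hj
    have := hqb (j + T) (by omega) (by push_cast; omega)
    simp only [b, if_neg (Nat.not_even_two_mul_add_one _)] at this
    rw [shiftMap_pow_apply, hk,
      show j + (q + T - (p + R)) + (p + R + K) = j + T + q + K by ring, this]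
    simp
  · have : ⇑(shiftMap ^ k) (fun j => z (j + (p + R + K))) =
        fun j => z (j + (k + (p + R + K))) := by
      ext j
      rw [shiftMap_pow_apply, add_assoc]
    rw [this]
    exact translate_mem hinv hz _

lemma SymbolicShadowing.isShiftOfFiniteType {A : Type*} [Finite A] [TopologicalSpace A]
    [DiscreteTopology A] {X : Set (ℤ → A)} (hne : X.Nonempty) (hcl : IsClosed X)
    (hinv : ⇑shiftMap '' X = X) {N : ℕ} (h : SymbolicShadowing X N) :
    IsShiftOfFiniteType X := by
  rw [isShiftOfFiniteType_iff hinv]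
  by_contra hcon
  have hbad : ∀ n : ℕ, ∃ b x y : ℤ → A, ∃ R : ℕ, b ∈ approx X n ∧ x ∈ X ∧ y ∈ X ∧
      (∀ j < (n : ℤ), b j = x j) ∧ (∀ j ≥ 0, b (j + (n + 2 * R + 1 : ℕ)) = y j) ∧
      ¬ ∃ z ∈ X, ∀ j, |j| ≤ (R : ℤ) → z j = b (j + (n + R)) := by
    intro n
    obtain ⟨b, hb, hbX⟩ := Set.not_subset.mp fun hs => hcon ⟨n, hs⟩
    obtain ⟨R, hR⟩ := not_forall.mp (mt (mem_of_forall_agree hcl) hbX)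
    obtain ⟨x, hx, hbx⟩ := hb (-(n + R))
    obtain ⟨y, hy, hby⟩ := hb (R + 1)
    set g := glue x (glue b y (R + 1)) (-(n + R)) with hg
    have hgA : g ∈ approx X n := by
      refine glue_mem_approx (fun i _ => subset_approx X n hx i) (fun i _ =>
        glue_mem_approx (fun i _ => hb i) (fun i _ => subset_approx X n hy i) hby i) ?_
      intro j h1 h2
      unfold glue
      rw [if_pos (by omega), hbx j h1 h2]
    refine ⟨_, _, _, R, translate_mem_approx hinv hgA (-(n + R)),
      translate_mem hinv hx (-(n + R)), translate_mem hinv hy (R + 1), ?_, ?_, ?_⟩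
    · intro j hj
      simp only [hg, glue]
      split_ifs with h1 h2
      · rfl
      · exact hbx _ (by omega) (by omega)
      · omega
    · intro j hj
      simp only [hg, glue]
      rw [if_neg (by push_cast; omega), if_neg (by push_cast; omega)]
      congr 1
      push_cast
      ring
    · rintro ⟨z, hz, hzb⟩
      refine hR ⟨z, hz, fun j hj => ?_⟩
      rw [hzb j hj]
      rw [abs_le] at hj
      simp only [hg, glue]
      rw [if_neg (by omega), if_pos (by omega), add_neg_cancel_right]
  choose b x y R hb hx hy hbx hby hbR using hbad
  obtain ⟨z, hz, n, K, hzb⟩ := h.exists_point_containing hne hcl hinv hb hx hy hbx hby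
  obtain ⟨p, -, hpb⟩ := hzb n le_rfl
  refine hbR n ⟨_, translate_mem hinv hz (n + R n + p + K), fun j hj => ?_⟩
  rw [abs_le] at hj
  rw [← hpb _ (by omega) (by push_cast; omega)]
  congr 1
  ring

/-- A nonempty closed shift-invariant subset `X ⊆ A^ℤ` (for `A` finite and discrete)
is a topologically transitive shift of finite type if and only if the shift restricted
to `X` has the two-sided limit shadowing property with a gap. -/
theorem stmt16 {A : Type*} [Fintype A] [Nonempty A] [DecidableEq A]
    [TopologicalSpace A] [DiscreteTopology A]
    (X : Set (ℤ → A)) (hne : X.Nonempty) (hcl : IsClosed X)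
    (hinv : ⇑shiftMap '' X = X) :
    (IsShiftOfFiniteType X ∧ ShiftTransitiveOn X) ↔
      ShiftTwoSidedLimitShadowingWithGapOn X := by
  constructor
  · rintro ⟨hsft, htr⟩
    obtain ⟨N, hN⟩ := symbolicShadowing_of_transitive hinv hsft htr
    exact gap_of_symbolicShadowing hinv hN
  · intro h
    obtain ⟨N, hN⟩ := symbolicShadowing_of_gap hne hinv h
    exact ⟨hN.isShiftOfFiniteType hne hcl hinv, hN.transitive hne hcl hinv⟩
end
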